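/- Let L = F_q with q = 2^n, let k ≥ 2, and let f(x) = x^{2^k+1} + h(x) ∈ L[x] where h has odd degree d with 3 ≤ d < 2^k+1 and d is not of the form 2^l+1 with gcd(l,k) > 1. Then φ(x,y,z) is absolutely irreducible, and f is not exceptional APN. -/

import Mathlib

open MvPolynomial

/-- A function `f : L → L` on a finite field is APN (almost perfect nonlinear) if
for all `a ≠ 0` and all `b`, the equation `f (x + a) + f x = b` has at most 2
solutions `x` (in characteristic 2, `+` and `-` coincide). -/
def IsAPN {L : Type} [Field L] [Fintype L] (f : L → L) : Prop :=
  ∀ a b : L, a ≠ 0 → Set.ncard {x : L | f (x + a) + f x = b} ≤ 2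

/-- The polynomial `(x+y)(x+z)(y+z)` in `L[x,y,z]` (variables `X 0, X 1, X 2`). -/
noncomputable def delta3 (L : Type) [CommRing L] : MvPolynomial (Fin 3) L :=
  (X 0 + X 1) * (X 0 + X 2) * (X 1 + X 2)

/-- The numerator `f(x) + f(y) + f(z) + f(x+y+z)` of `φ`, as an element of `L[x,y,z]`. -/
noncomputable def phiNum {L : Type} [CommRing L] (f : Polynomial L) :
    MvPolynomial (Fin 3) L :=
  Polynomial.aeval (X 0 : MvPolynomial (Fin 3) L) f +
    Polynomial.aeval (X 1 : MvPolynomial (Fin 3) L) f +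
    Polynomial.aeval (X 2 : MvPolynomial (Fin 3) L) f +
    Polynomial.aeval (X 0 + X 1 + X 2 : MvPolynomial (Fin 3) L) f

/-- A polynomial over a field `L` is absolutely irreducible if it is irreducible over
the algebraic closure of `L`. -/
def AbsolutelyIrreducible {L : Type} [Field L] (p : MvPolynomial (Fin 3) L) : Prop :=
  Irreducible (MvPolynomial.map (algebraMap L (AlgebraicClosure L)) p)

/-- `f ∈ L[x]` is exceptional APN if the induced function is APN on `L = F_q` and on
infinitely many extensions `F_{q^m}` of `L`. -/
def IsExceptionalAPN {L : Type} [Field L] [Fintype L] (f : Polynomial L) : Prop :=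
  IsAPN (fun x => Polynomial.eval x f) ∧
    {m : ℕ | ∀ (M : Type) [Field M] [Fintype M], ∀ e : L →+* M,
      Fintype.card M = Fintype.card L ^ m →
        IsAPN (fun x => Polynomial.eval x (f.map e))}.Infinite

theorem resultant_ne_zero_of_irreducible {A : Type*} [CommRing A] [IsDomain A]
    [IsIntegrallyClosed A] {φ S : Polynomial A} (hm : φ.Monic) (hirr : Irreducible φ)
    (hS : ¬ φ ∣ S) {n : ℕ} (hn : S.natDegree ≤ n) :
    φ.resultant S φ.natDegree n ≠ 0 := by
  obtain ⟨k, rfl⟩ := Nat.exists_eq_add_of_le hn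
  rw [Polynomial.resultant_add_right_deg _ _ _ _ _ le_rfl, Polynomial.coeff_natDegree,
    hm.leadingCoeff, one_pow, one_mul]
  have hinj := IsFractionRing.injective A (FractionRing A)
  intro h0
  have h1 : (φ.map (algebraMap A (FractionRing A))).resultant
      (S.map (algebraMap A (FractionRing A))) = 0 := by
    rw [Polynomial.natDegree_map_eq_of_injective hinj,
      Polynomial.natDegree_map_eq_of_injective hinj, Polynomial.resultant_map_map, h0, map_zero]
  rw [Polynomial.resultant_eq_zero_iff] at h1
  refine h1.2 ((hm.irreducible_iff_irreducible_map_fraction_map.1 hirr).coprime_iff_not_dvd.2 ?_)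
  rwa [Polynomial.map_dvd_map _ hinj hm]

theorem exists_bezout_of_irreducible {A : Type*} [CommRing A] [IsDomain A]
    [IsIntegrallyClosed A] {φ S : Polynomial A} (hm : φ.Monic) (hirr : Irreducible φ)
    (hS : ¬ φ ∣ S) :
    ∃ u w : Polynomial A, ∃ s : A, s ≠ 0 ∧ φ * u + S * w = Polynomial.C s := by
  obtain ⟨u, w, -, -, h⟩ := Polynomial.exists_mul_add_mul_eq_C_resultant φ S le_rfl le_rfl
    (Or.inl (hm.natDegree_pos_of_not_isUnit hirr.not_isUnit).ne')
  exact ⟨u, w, _, resultant_ne_zero_of_irreducible hm hirr hS le_rfl, h⟩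

theorem MvPolynomial.exists_eval_ne_zero {σ K : Type*} [Field K] [Infinite K]
    {f : MvPolynomial σ K} (hf : f ≠ 0) : ∃ a : σ → K, eval a f ≠ 0 := by
  by_contra! h
  exact hf (MvPolynomial.funext fun a => by simpa using h a)

section SurfacePoints

variable {σ K : Type*} [Field K]

/-- The `K`-point of `K[σ][X] / (φ)` given by a point `a` of affine space and a root `z` of the
fibre of `φ` over `a`. -/
noncomputable def fibrePoint (φ : Polynomial (MvPolynomial σ K)) (a : σ → K) (z : K)
    (h : (φ.map (eval a)).eval z = 0) : AdjoinRoot φ →+* K :=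
  AdjoinRoot.lift (eval a) z (by rwa [Polynomial.eval_map] at h)

@[simp]
theorem fibrePoint_of (φ : Polynomial (MvPolynomial σ K)) (a : σ → K) (z : K)
    (h : (φ.map (eval a)).eval z = 0) (p : MvPolynomial σ K) :
    fibrePoint φ a z h (AdjoinRoot.of φ p) = eval a p := by
  simp [fibrePoint]

@[simp]
theorem fibrePoint_root (φ : Polynomial (MvPolynomial σ K)) (a : σ → K) (z : K)
    (h : (φ.map (eval a)).eval z = 0) :
    fibrePoint φ a z h (AdjoinRoot.root φ) = z := by
  simp [fibrePoint]

theorem fibrePoint_mk (φ : Polynomial (MvPolynomial σ K)) (a : σ → K) (z : K)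
    (h : (φ.map (eval a)).eval z = 0) (p : Polynomial (MvPolynomial σ K)) :
    fibrePoint φ a z h (AdjoinRoot.mk φ p) = (p.map (eval a)).eval z := by
  simp [fibrePoint, Polynomial.eval_map]

theorem exists_fibrePoint_ne_zero [IsAlgClosed K] {φ : Polynomial (MvPolynomial σ K)}
    (hm : φ.Monic) (hirr : Irreducible φ) {S : AdjoinRoot φ} (hS : S ≠ 0) :
    ∃ a z, ∃ h : (φ.map (eval a)).eval z = 0, fibrePoint φ a z h S ≠ 0 := by
  have : Infinite K := IsAlgClosed.instInfinite
  obtain ⟨p, rfl⟩ := AdjoinRoot.mk_surjective S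
  rw [Ne, AdjoinRoot.mk_eq_zero] at hS
  obtain ⟨u, w, s, hs, e⟩ := exists_bezout_of_irreducible hm hirr hS
  obtain ⟨a, ha⟩ := MvPolynomial.exists_eval_ne_zero hs
  have hd : (φ.map (eval a)).degree ≠ 0 := by
    rw [hm.degree_map, Polynomial.degree_eq_natDegree hm.ne_zero]
    exact_mod_cast (hm.natDegree_pos_of_not_isUnit hirr.not_isUnit).ne'
  obtain ⟨z, hz⟩ := IsAlgClosed.exists_root _ hd
  refine ⟨a, z, hz.eq_zero, fun h0 => ha ?_⟩
  rw [fibrePoint_mk] at h0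
  have := congrArg (fun f => (f.map (eval a)).eval z) e
  simpa [h0, hz.eq_zero] using this.symm

theorem MvPolynomial.sum_mul_monomial_smul_ne_zero [Finite σ] (T : Finset (σ →₀ ℕ))
    (c : (σ →₀ ℕ) → MvPolynomial σ K) {v₀ : σ →₀ ℕ} (hv₀ : v₀ ∈ T) (hc : c v₀ ≠ 0) :
    ∃ Q₀ : ℕ, ∀ Q ≥ Q₀, ∑ v ∈ T, c v * monomial (Q • v) 1 ≠ 0 := by
  classical
  have := Fintype.ofFinite σ
  obtain ⟨w, hw⟩ := MvPolynomial.ne_zero_iff.1 hc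
  refine ⟨(T.sup fun v => Finset.univ.sup fun i => degreeOf i (c v)) + 1, fun Q hQ h0 => hw ?_⟩
  have hb : ∀ v ∈ T, ∀ i, degreeOf i (c v) < Q := fun v hv i =>
    lt_of_lt_of_le (Nat.lt_succ_of_le ((Finset.le_sup (f := fun i => degreeOf i (c v))
      (Finset.mem_univ i)).trans
      (Finset.le_sup (f := fun v => Finset.univ.sup fun i => degreeOf i (c v)) hv))) hQ
  have hb' : ∀ v ∈ T, ∀ u, coeff u (c v) ≠ 0 → ∀ i, u i < Q := fun v hv u hu i =>
    lt_of_le_of_lt (MvPolynomial.monomial_le_degreeOf i (mem_support_iff.2 hu)) (hb v hv i)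
  have h1 := congrArg (coeff (w + Q • v₀)) h0
  rw [coeff_sum, Finset.sum_eq_single v₀] at h1
  · simpa using h1
  · intro v hv hne
    rw [coeff_mul_monomial']
    split_ifs with hle
    · rw [mul_one]
      by_contra hu
      obtain ⟨i, hi⟩ : ∃ i, v i ≠ v₀ i := by
        by_contra! h
        exact hne (Finsupp.ext h)
      have h2 := hb' v hv _ hu i
      have h3 := hb' v₀ hv₀ _ hw i
      have h4 := hle i
      simp only [Finsupp.coe_tsub, Finsupp.coe_add, Finsupp.coe_smul, Pi.sub_apply, Pi.add_apply,
        Pi.smul_apply, smul_eq_mul] at h2 h4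
      rcases lt_or_gt_of_ne hi with h5 | h5
      · have : Q * (v i + 1) ≤ Q * v₀ i := Nat.mul_le_mul_left _ h5
        rw [mul_add] at this
        omega
      · have : Q * (v₀ i + 1) ≤ Q * v i := Nat.mul_le_mul_left _ h5
        rw [mul_add] at this
        omega
    · rfl
  · exact fun h => (h hv₀).elim

/-- The coordinates of an element of `AdjoinRoot φ` with respect to the powers of the root. -/
noncomputable def rootCoord {A : Type*} [CommRing A] {φ : Polynomial A} (hm : φ.Monic) (l : ℕ) :
    AdjoinRoot φ →ₗ[A] A :=
  Polynomial.lcoeff A l ∘ₗ AdjoinRoot.modByMonicHom hm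

theorem rootCoord_mk {A : Type*} [CommRing A] {φ : Polynomial A} (hm : φ.Monic) (l : ℕ)
    (p : Polynomial A) : rootCoord hm l (AdjoinRoot.mk φ p) = (p %ₘ φ).coeff l := by
  simp [rootCoord, AdjoinRoot.modByMonicHom_mk]

theorem sum_rootCoord {A : Type*} [CommRing A] [Nontrivial A] {φ : Polynomial A} (hm : φ.Monic)
    (b : AdjoinRoot φ) :
    ∑ l ∈ Finset.range φ.natDegree, AdjoinRoot.of φ (rootCoord hm l b) * AdjoinRoot.root φ ^ l =
      b := by
  rcases eq_or_ne φ.natDegree 0 with h0 | h0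
  · have h1 := Polynomial.eq_one_of_monic_natDegree_zero hm h0
    have : Subsingleton (AdjoinRoot φ) := by
      subst h1
      exact Ideal.Quotient.subsingleton_iff.2 (Ideal.span_singleton_one)
    exact Subsingleton.elim _ _
  obtain ⟨p, rfl⟩ := AdjoinRoot.mk_surjective b
  simp only [rootCoord_mk]
  have h1 : AdjoinRoot.mk φ p = AdjoinRoot.mk φ (p %ₘ φ) := by
    rw [AdjoinRoot.mk_eq_mk]
    exact ⟨p /ₘ φ, by rw [Polynomial.modByMonic_eq_sub_mul_div _]; ring⟩
  have h2 : (p %ₘ φ).natDegree < φ.natDegree := Polynomial.natDegree_modByMonic_lt _ hm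
    (fun h => h0 (by simp [h]))
  conv_rhs => rw [h1, Polynomial.as_sum_range' _ _ h2]
  simp [← Polynomial.C_mul_X_pow_eq_monomial]

theorem eq_zero_of_rootCoord_eq_zero {A : Type*} [CommRing A] [Nontrivial A] {φ : Polynomial A}
    (hm : φ.Monic) {b : AdjoinRoot φ} (h : ∀ l < φ.natDegree, rootCoord hm l b = 0) : b = 0 := by
  rw [← sum_rootCoord hm b]
  exact Finset.sum_eq_zero fun l hl => by simp [h l (Finset.mem_range.1 hl)]

theorem aeval_X_pow_ne_zero [Finite σ] {φ : Polynomial (MvPolynomial σ K)} (hm : φ.Monic)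
    {N : MvPolynomial σ (AdjoinRoot φ)} (hN : N ≠ 0) :
    ∃ Q₀ : ℕ, ∀ Q ≥ Q₀,
      eval (fun i => AdjoinRoot.of φ (X i ^ Q)) N ≠ 0 := by
  obtain ⟨v₀, hv₀⟩ := MvPolynomial.ne_zero_iff.1 hN
  obtain ⟨l, hl⟩ : ∃ l, rootCoord hm l (coeff v₀ N) ≠ 0 := by
    by_contra! h
    exact hv₀ (eq_zero_of_rootCoord_eq_zero hm fun l _ => h l)
  obtain ⟨Q₀, hQ₀⟩ := MvPolynomial.sum_mul_monomial_smul_ne_zero N.support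
    (fun v => rootCoord hm l (coeff v N)) (mem_support_iff.2 hv₀) hl
  refine ⟨Q₀, fun Q hQ h0 => hQ₀ Q hQ ?_⟩
  rw [eval_eq] at h0
  have h1 := congrArg (rootCoord hm l) h0
  rw [map_sum, map_zero] at h1
  rw [← h1]
  refine Finset.sum_congr rfl fun v _ => ?_
  have h2 : ∏ i ∈ v.support, AdjoinRoot.of φ (X i ^ Q) ^ v i =
      AdjoinRoot.of φ (monomial (Q • v) 1) := by
    rw [monomial_eq, Finsupp.prod_of_support_subset _ Finsupp.support_smul _ (by simp)]
    simp [← pow_mul]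
  rw [h2, mul_comm (coeff v N), ← AdjoinRoot.algebraMap_eq, ← Algebra.smul_def, map_smul,
    smul_eq_mul, mul_comm]

theorem sum_mul_pow_ne_zero [IsAlgClosed K] [Finite σ] {φ : Polynomial (MvPolynomial σ K)}
    (hm : φ.Monic) (hirr : Irreducible φ) (T : Finset (σ →₀ ℕ))
    (S : (σ →₀ ℕ) → ℕ → AdjoinRoot φ) {v₀ : σ →₀ ℕ} (hv₀ : v₀ ∈ T) {j₀ : ℕ}
    (hj₀ : j₀ < φ.natDegree) (hS : S v₀ j₀ ≠ 0) :
    ∃ Q₀ : ℕ, ∀ Q ≥ Q₀,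
      φ.eval₂ (eval₂Hom (AdjoinRoot.of φ |>.comp C) fun i => AdjoinRoot.of φ (X i ^ Q))
        (AdjoinRoot.root φ ^ Q) = 0 →
      ∑ j ∈ Finset.range φ.natDegree, (∑ v ∈ T, S v j * AdjoinRoot.of φ (monomial (Q • v) 1)) *
        AdjoinRoot.root φ ^ (Q * j) ≠ 0 := by
  classical
  let R : Polynomial (MvPolynomial σ (AdjoinRoot φ)) :=
    ∑ j ∈ Finset.range φ.natDegree,
      Polynomial.C (∑ v ∈ T, monomial v (S v j)) * Polynomial.X ^ j
  let φ' : Polynomial (MvPolynomial σ (AdjoinRoot φ)) :=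
    φ.map (MvPolynomial.map ((AdjoinRoot.of φ).comp C))
  have hφ' : φ'.natDegree ≤ φ.natDegree := Polynomial.natDegree_map_le
  have hRcoeff : ∀ j < φ.natDegree, R.coeff j = ∑ v ∈ T, monomial v (S v j) := by
    intro j hj
    simp only [R, Polynomial.finsetSum_coeff, Polynomial.coeff_C_mul_X_pow]
    rw [Finset.sum_ite_eq, if_pos (Finset.mem_range.2 hj)]
  have hR : R.natDegree ≤ φ.natDegree - 1 := by
    refine Polynomial.natDegree_sum_le_of_forall_le _ _ fun j hj => ?_
    have := Finset.mem_range.1 hj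
    exact (Polynomial.natDegree_C_mul_X_pow_le _ _).trans (by omega)
  have hN : φ'.resultant R φ.natDegree (φ.natDegree - 1) ≠ 0 := by
    obtain ⟨a, z, hz, hne⟩ := exists_fibrePoint_ne_zero hm hirr hS
    set P := fibrePoint φ a z hz
    intro h0
    have h1 := congrArg (MvPolynomial.map (σ := σ) P) h0
    rw [map_zero, ← Polynomial.resultant_map_map] at h1
    have h2 : φ'.map (MvPolynomial.map P) = φ := by
      rw [Polynomial.map_map]
      convert Polynomial.map_id
      ext i <;> simp [P]
    rw [h2] at h1
    refine resultant_ne_zero_of_irreducible hm hirr ?_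
      (Polynomial.natDegree_map_le.trans hR) h1
    refine Polynomial.Monic.not_dvd_of_natDegree_lt hm ?_ ?_
    · intro h3
      have h4 := congrArg (fun f => coeff v₀ (Polynomial.coeff f j₀)) h3
      rw [Polynomial.coeff_map, hRcoeff _ hj₀] at h4
      simp [coeff_sum, coeff_monomial, hv₀] at h4
      exact hne h4
    · exact lt_of_le_of_lt (Polynomial.natDegree_map_le.trans hR) (by omega)
  obtain ⟨u, w, -, -, e⟩ := Polynomial.exists_mul_add_mul_eq_C_resultant φ' R hφ' hR
    (Or.inl (by omega))
  obtain ⟨Q₀, hQ₀⟩ := aeval_X_pow_ne_zero hm hN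
  refine ⟨Q₀, fun Q hQ hφ0 h0 => hQ₀ Q hQ ?_⟩
  have h1 := congrArg (Polynomial.eval₂ (eval fun i => AdjoinRoot.of φ (X i ^ Q))
    (AdjoinRoot.root φ ^ Q)) e
  rw [Polynomial.eval₂_C, Polynomial.eval₂_add, Polynomial.eval₂_mul, Polynomial.eval₂_mul] at h1
  rw [← h1]
  have h2 : φ'.eval₂ (eval fun i => AdjoinRoot.of φ (X i ^ Q)) (AdjoinRoot.root φ ^ Q) = 0 := by
    rw [Polynomial.eval₂_map, ← hφ0]
    congr 1
    ext i <;> simp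
  have h3 : R.eval₂ (eval fun i => AdjoinRoot.of φ (X i ^ Q)) (AdjoinRoot.root φ ^ Q) = 0 := by
    rw [← h0, Polynomial.eval₂_finsetSum]
    refine Finset.sum_congr rfl fun j _ => ?_
    rw [Polynomial.eval₂_mul, Polynomial.eval₂_C, Polynomial.eval₂_X_pow, ← pow_mul, map_sum]
    congr 1
    refine Finset.sum_congr rfl fun v _ => ?_
    rw [eval_monomial, monomial_eq, Finsupp.prod_of_support_subset _ Finsupp.support_smul _
      (by simp)]
    simp [← pow_mul, Finsupp.prod]
  rw [h2, h3, zero_mul, zero_mul, add_zero]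

theorem degreeOf_coeff_X_pow_modByMonic_le {φ : Polynomial (MvPolynomial σ K)} (hm : φ.Monic)
    (hD : 0 < φ.natDegree) {i : σ} {c : ℕ} (hc : ∀ l, degreeOf i (φ.coeff l) ≤ c) (n l : ℕ) :
    degreeOf i ((Polynomial.X ^ n %ₘ φ).coeff l) ≤ c * n := by
  induction n generalizing l with
  | zero =>
    rw [pow_zero, (Polynomial.modByMonic_eq_self_iff hm).2 (by
      rw [Polynomial.degree_one, Polynomial.degree_eq_natDegree hm.ne_zero]; exact_mod_cast hD),
      Polynomial.coeff_one]
    split_ifs <;> simp [degreeOf_zero]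
  | succ n ih =>
    set r := Polynomial.X ^ n %ₘ φ with hr
    have hrdeg : r.natDegree < φ.natDegree :=
      Polynomial.natDegree_modByMonic_lt _ hm (fun h => hD.ne' (by simp [h]))
    have h1 : Polynomial.X ^ (n + 1) %ₘ φ =
        Polynomial.X * r - Polynomial.C (r.coeff (φ.natDegree - 1)) * φ := by
      refine (Polynomial.div_modByMonic_unique (Polynomial.X * (Polynomial.X ^ n /ₘ φ) +
        Polynomial.C (r.coeff (φ.natDegree - 1))) _ hm ⟨?_, ?_⟩).2
      · have := Polynomial.modByMonic_add_div (Polynomial.X ^ n) φ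
        rw [← hr] at this
        rw [pow_succ]
        linear_combination Polynomial.X * this
      · rw [Polynomial.degree_eq_natDegree hm.ne_zero, Polynomial.degree_lt_iff_coeff_zero]
        intro k hk
        obtain ⟨k, rfl⟩ : ∃ k', k = k' + 1 := ⟨k - 1, by omega⟩
        have hk' : φ.natDegree ≤ k + 1 := hk
        rw [Polynomial.coeff_sub, Polynomial.coeff_X_mul, Polynomial.coeff_C_mul]
        rcases hk'.eq_or_lt with h2 | h2
        · rw [← h2, Polynomial.coeff_natDegree, hm.leadingCoeff, mul_one, h2, Nat.add_sub_cancel,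
            sub_self]
        · rw [Polynomial.coeff_eq_zero_of_natDegree_lt h2,
            Polynomial.coeff_eq_zero_of_natDegree_lt (by omega), mul_zero, sub_zero]
    rw [h1, Polynomial.coeff_sub, Polynomial.coeff_C_mul]
    refine (degreeOf_sub_le _ _ _).trans (max_le ?_ ?_)
    · rcases l with _ | l
      · simp [degreeOf_zero]
      · rw [Polynomial.coeff_X_mul]
        exact (ih l).trans (Nat.mul_le_mul_left _ n.le_succ)
    · refine (degreeOf_mul_le _ _ _).trans ?_
      rw [mul_add, mul_one]
      exact add_le_add (ih _) (hc _)

theorem MvPolynomial.exists_eq_sum_pow_mul_prod [Fintype σ] [DecidableEq σ] (p : ℕ)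
    [Fact p.Prime] [CharP K p] [PerfectRing K p] (e : ℕ) (f : MvPolynomial σ K) :
    ∃ τ : (σ → Fin (p ^ e)) → MvPolynomial σ K,
      f = ∑ w, τ w ^ p ^ e * ∏ i, X i ^ (w i : ℕ) := by
  classical
  have hp : 0 < p ^ e := pow_pos (Fact.out : p.Prime).pos _
  induction f using MvPolynomial.induction_on' with
  | monomial u c =>
    obtain ⟨c, rfl⟩ := (bijective_iterateFrobenius K p e).2 c
    refine ⟨Pi.single (fun i => ⟨u i % p ^ e, Nat.mod_lt _ hp⟩)
      (C c * ∏ i, X i ^ (u i / p ^ e)), ?_⟩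
    rw [Finset.sum_eq_single (fun i => ⟨u i % p ^ e, Nat.mod_lt _ hp⟩)]
    · rw [Pi.single_eq_same, mul_pow, ← Finset.prod_pow, mul_assoc, ← Finset.prod_mul_distrib,
        monomial_eq, iterateFrobenius_def, C_pow,
        Finsupp.prod_of_support_subset _ (Finset.subset_univ _) _ (by simp)]
      congr 1
      refine Finset.prod_congr rfl fun i _ => ?_
      rw [← pow_mul, ← pow_add, Nat.div_add_mod']
    · intro w _ hw
      rw [Pi.single_eq_of_ne hw, zero_pow hp.ne', zero_mul]
    · simp
  | add f g hf hg =>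
    obtain ⟨τ₁, h₁⟩ := hf
    obtain ⟨τ₂, h₂⟩ := hg
    refine ⟨τ₁ + τ₂, ?_⟩
    simp only [Pi.add_apply, add_pow_char_pow, add_mul, Finset.sum_add_distrib]
    exact congrArg₂ _ h₁ h₂

theorem exists_ne_zero_sum_mul_eq_zero {A α β : Type*} [CommRing A] [Nontrivial A] [Fintype α]
    [Fintype β] (h : Fintype.card β < Fintype.card α) (τ : β → α → A) :
    ∃ r : α → A, r ≠ 0 ∧ ∀ b, ∑ a, τ b a * r a = 0 := by
  by_contra! hcon
  refine h.not_ge (card_le_of_injective A (Matrix.mulVecLin (Matrix.of τ)) ?_)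
  rw [← LinearMap.ker_eq_bot, LinearMap.ker_eq_bot']
  intro r hr
  by_contra hne
  obtain ⟨b, hb⟩ := hcon r hne
  exact hb (congrFun hr b)

/-- The auxiliary polynomial of Stepanov's method: a nontrivial relation satisfied by all pairs of
distinct points in a fibre of `φ`. -/
theorem exists_relation_of_distinct_roots [Fintype σ] [DecidableEq σ] (p : ℕ) [Fact p.Prime]
    [CharP K p] [PerfectRing K p] {φ : Polynomial (MvPolynomial σ K)} (hm : φ.Monic)
    (hirr : Irreducible φ) (e N : ℕ)
    (hcard : φ.natDegree * (φ.natDegree - 1) * (p ^ e) ^ Fintype.card σ <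
      φ.natDegree * φ.natDegree * N ^ Fintype.card σ) :
    ∃ r : (σ → Fin N) × Fin φ.natDegree × Fin φ.natDegree → MvPolynomial σ K, r ≠ 0 ∧
      ∀ (a : σ → K) (z z' : K), (φ.map (eval a)).eval z = 0 → (φ.map (eval a)).eval z' = 0 →
        z ≠ z' → ∑ x, eval a (r x) ^ p ^ e * (∏ i, a i ^ (x.1 i : ℕ)) *
          z ^ ((x.2.1 : ℕ) * p ^ e) * z' ^ (x.2.2 : ℕ) = 0 := by
  classical
  have hD : 0 < φ.natDegree := hm.natDegree_pos_of_not_isUnit hirr.not_isUnit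
  have : Nontrivial (AdjoinRoot φ) := AdjoinRoot.nontrivial _ (by
    rw [Polynomial.degree_eq_natDegree hm.ne_zero]; exact_mod_cast hD.ne')
  set φ' := φ.map (AdjoinRoot.of φ)
  have hm' : φ'.Monic := hm.map _
  set g := φ' /ₘ (Polynomial.X - Polynomial.C (AdjoinRoot.root φ))
  have hg : (Polynomial.X - Polynomial.C (AdjoinRoot.root φ)) * g = φ' :=
    Polynomial.mul_divByMonic_eq_iff_isRoot.2 (AdjoinRoot.isRoot_root φ)
  have hgm : g.Monic := (Polynomial.monic_X_sub_C _).of_mul_monic_left (hg ▸ hm')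
  have hgd : g.natDegree = φ.natDegree - 1 := by
    rw [Polynomial.natDegree_divByMonic _ (Polynomial.monic_X_sub_C _), hm.natDegree_map,
      Polynomial.natDegree_X_sub_C]
  let s : ℕ → ℕ → AdjoinRoot φ := fun j l => (Polynomial.X ^ j %ₘ g).coeff l
  let b : (σ → Fin N) × Fin φ.natDegree × Fin φ.natDegree → ℕ → AdjoinRoot φ := fun x l =>
    AdjoinRoot.of φ (∏ i, X i ^ (x.1 i : ℕ)) * AdjoinRoot.root φ ^ ((x.2.1 : ℕ) * p ^ e) *
      s x.2.2 l
  have hdec : ∀ x (l l' : ℕ), ∃ τ : (σ → Fin (p ^ e)) → MvPolynomial σ K,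
      rootCoord hm l (b x l') = ∑ w, τ w ^ p ^ e * ∏ i, X i ^ (w i : ℕ) := fun x l l' =>
    MvPolynomial.exists_eq_sum_pow_mul_prod p e _
  choose τ hτ using hdec
  obtain ⟨r, hr0, hr⟩ := exists_ne_zero_sum_mul_eq_zero
    (β := (σ → Fin (p ^ e)) × Fin φ.natDegree × Fin (φ.natDegree - 1)) (by
      simp only [Fintype.card_prod, Fintype.card_fun, Fintype.card_fin]
      linarith) (fun y x => τ x y.2.1 y.2.2 y.1)
  refine ⟨r, hr0, fun a z z' hz hz' hne => ?_⟩
  set P := fibrePoint φ a z hz with hP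
  have hφ'P : φ'.map P = φ.map (eval a) := by
    rw [Polynomial.map_map]
    congr 1
    ext i <;> simp [P]
  have hgz : g.eval₂ P z' = 0 := by
    have h1 := congrArg (Polynomial.eval₂ P z') hg
    rw [Polynomial.eval₂_mul, Polynomial.eval₂_eq_eval_map (p := φ'), hφ'P, hz'] at h1
    refine (mul_eq_zero.1 h1).resolve_left ?_
    simpa [P, sub_eq_zero] using hne.symm
  have hz'pow : ∀ j, z' ^ j = ∑ l : Fin (φ.natDegree - 1), P (s j l) * z' ^ (l : ℕ) := by
    intro j
    have h1 := congrArg (Polynomial.eval₂ P z')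
      (Polynomial.modByMonic_add_div (Polynomial.X ^ j) g)
    rw [Polynomial.eval₂_add, Polynomial.eval₂_mul, hgz, zero_mul, add_zero,
      Polynomial.eval₂_X_pow] at h1
    rw [← h1, Polynomial.eval₂_eq_sum_range' P (n := φ.natDegree - 1), Finset.sum_range]
    rw [← hgd]
    refine Polynomial.natDegree_modByMonic_lt _ hgm fun h => ?_
    rw [h, Polynomial.eval₂_one] at hgz
    exact one_ne_zero hgz
  have hPb : ∀ x l', P (b x l') = ∑ l : Fin φ.natDegree, ∑ w : σ → Fin (p ^ e),
      eval a (τ x l l' w) ^ p ^ e * (∏ i, a i ^ (w i : ℕ)) * z ^ (l : ℕ) := by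
    intro x l'
    rw [← sum_rootCoord hm (b x l'), Finset.sum_range, map_sum]
    refine Finset.sum_congr rfl fun l _ => ?_
    rw [hτ, ← Finset.sum_mul]
    simp [P]
  have hterm : ∀ x, eval a (r x) ^ p ^ e * (∏ i, a i ^ (x.1 i : ℕ)) *
      z ^ ((x.2.1 : ℕ) * p ^ e) * z' ^ (x.2.2 : ℕ) =
      ∑ l' : Fin (φ.natDegree - 1), ∑ l : Fin φ.natDegree, ∑ w : σ → Fin (p ^ e),
        (eval a (τ x l l' w * r x)) ^ p ^ e *
          ((∏ i, a i ^ (w i : ℕ)) * z ^ (l : ℕ) * z' ^ (l' : ℕ)) := by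
    intro x
    rw [hz'pow, Finset.mul_sum]
    refine Finset.sum_congr rfl fun l' _ => ?_
    trans eval a (r x) ^ p ^ e * P (b x l') * z' ^ (l' : ℕ)
    · simp [b, P]
      ring
    rw [hPb, Finset.mul_sum, Finset.sum_mul]
    refine Finset.sum_congr rfl fun l _ => ?_
    rw [Finset.mul_sum, Finset.sum_mul]
    refine Finset.sum_congr rfl fun w _ => ?_
    rw [map_mul, mul_pow]
    ring
  rw [Finset.sum_congr rfl fun x _ => hterm x, Finset.sum_comm]
  refine Finset.sum_eq_zero fun l' _ => ?_
  rw [Finset.sum_comm]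
  refine Finset.sum_eq_zero fun l _ => ?_
  rw [Finset.sum_comm]
  refine Finset.sum_eq_zero fun w _ => ?_
  rw [← Finset.sum_mul, ← sum_pow_char_pow, ← map_sum, hr (w, l, l'), map_zero,
    zero_pow (pow_pos (Fact.out : p.Prime).pos _).ne', zero_mul]

theorem exists_finset_pow_eq_self [IsAlgClosed K] (p : ℕ) [hp : Fact p.Prime] [CharP K p] {e : ℕ}
    (he : e ≠ 0) : ∃ S : Finset K, S.card = p ^ e ∧ ∀ x, x ∈ S ↔ x ^ p ^ e = x := by
  classical
  have h1 : 1 < p ^ e := Nat.one_lt_pow he hp.out.one_lt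
  have hne := FiniteField.X_pow_card_sub_X_ne_zero K h1
  refine ⟨(Polynomial.X ^ p ^ e - Polynomial.X : Polynomial K).roots.toFinset, ?_, fun x => ?_⟩
  · rw [Multiset.toFinset_card_of_nodup (Polynomial.nodup_roots
      (galois_poly_separable p _ (dvd_pow_self p he))),
      IsAlgClosed.card_roots_eq_natDegree,
      FiniteField.X_pow_card_sub_X_natDegree_eq K h1]
  · simp [hne, sub_eq_zero]

theorem eval_rootCoord_eq_zero [IsAlgClosed K] {φ : Polynomial (MvPolynomial σ K)} (hm : φ.Monic)
    (hD : 0 < φ.natDegree) {a : σ → K} (hsep : (φ.map (eval a)).Separable) {b : AdjoinRoot φ}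
    (hb : ∀ z (hz : (φ.map (eval a)).eval z = 0), fibrePoint φ a z hz b = 0) {l : ℕ}
    (hl : l < φ.natDegree) : eval a (rootCoord hm l b) = 0 := by
  classical
  set q : Polynomial K := ∑ l ∈ Finset.range φ.natDegree,
    Polynomial.C (eval a (rootCoord hm l b)) * Polynomial.X ^ l with hq
  have hq0 : q = 0 := by
    refine Polynomial.eq_zero_of_natDegree_lt_card_of_eval_eq_zero' q
      (φ.map (eval a)).roots.toFinset (fun z hz => ?_) ?_
    · rw [Multiset.mem_toFinset, Polynomial.mem_roots (hm.map _).ne_zero] at hz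
      have hz' : (φ.map (eval a)).eval z = 0 := hz
      rw [← hb z hz', ← sum_rootCoord hm b, hq, Polynomial.eval_finsetSum, map_sum]
      exact Finset.sum_congr rfl fun l _ => by
        simp only [Polynomial.eval_mul, Polynomial.eval_C, Polynomial.eval_pow,
          Polynomial.eval_X, map_mul, map_pow, fibrePoint_of, fibrePoint_root]
    · rw [Multiset.toFinset_card_of_nodup (Polynomial.nodup_roots hsep),
        IsAlgClosed.card_roots_eq_natDegree, hm.natDegree_map]
      have : q.natDegree ≤ φ.natDegree - 1 := by
        refine Polynomial.natDegree_sum_le_of_forall_le _ _ fun j hj => ?_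
        have := Finset.mem_range.1 hj
        exact (Polynomial.natDegree_C_mul_X_pow_le _ _).trans (by omega)
      omega
  have h1 := congrArg (fun f => Polynomial.coeff f l) hq0
  simpa [hq, Polynomial.finsetSum_coeff, Polynomial.coeff_C_mul_X_pow, hl] using h1

theorem degreeOf_rootCoord_sum_le {ι : Type*} {φ : Polynomial (MvPolynomial σ K)} (hm : φ.Monic)
    (hD : 0 < φ.natDegree) {i : σ} {c : ℕ} (hc : ∀ l, degreeOf i (φ.coeff l) ≤ c)
    (s : Finset ι) (f : ι → MvPolynomial σ K) (n : ι → ℕ) {B : ℕ}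
    (hB : ∀ x ∈ s, degreeOf i (f x) + c * n x ≤ B) (l : ℕ) :
    degreeOf i (rootCoord hm l (∑ x ∈ s, AdjoinRoot.of φ (f x) * AdjoinRoot.root φ ^ n x)) ≤ B := by
  rw [map_sum]
  refine (degreeOf_sum_le _ _ _).trans (Finset.sup_le fun x hx => le_trans ?_ (hB x hx))
  rw [← AdjoinRoot.algebraMap_eq, ← Algebra.smul_def, map_smul, smul_eq_mul, ← AdjoinRoot.mk_X,
    ← map_pow, rootCoord_mk]
  exact (degreeOf_mul_le _ _ _).trans
    (add_le_add_right (degreeOf_coeff_X_pow_modByMonic_le hm hD hc _ _) _)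

theorem eval₂_pow_of_map_iterateFrobenius_eq {B : Type*} [CommRing B] (p : ℕ) [ExpChar K p]
    [ExpChar B p] {φ : Polynomial (MvPolynomial σ K)} {e : ℕ}
    (hφ : φ.map (MvPolynomial.map (iterateFrobenius K p e)) = φ) (g : MvPolynomial σ K →+* B)
    (b : B) :
    φ.eval₂ (eval₂Hom (g.comp C) fun i => g (X i ^ p ^ e)) (b ^ p ^ e) =
      φ.eval₂ g b ^ p ^ e := by
  have h1 := Polynomial.hom_eval₂ φ g (iterateFrobenius B p e) b
  rw [iterateFrobenius_def, iterateFrobenius_def] at h1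
  rw [h1]
  conv_lhs => rw [← hφ, Polynomial.eval₂_map]
  congr 1
  refine MvPolynomial.ringHom_ext (fun c => ?_) fun i => ?_ <;> simp [iterateFrobenius_def]

theorem map_eval_pow_eq (p : ℕ) [ExpChar K p] {φ : Polynomial (MvPolynomial σ K)} {e : ℕ}
    (hφ : φ.map (MvPolynomial.map (iterateFrobenius K p e)) = φ) (a : σ → K) (z : K)
    (hz : (φ.map (eval a)).eval z = 0) (ha : ∀ i, a i ^ p ^ e = a i) :
    (φ.map (eval a)).eval (z ^ p ^ e) = 0 := by
  have h1 := eval₂_pow_of_map_iterateFrobenius_eq p hφ (eval a) z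
  rw [← Polynomial.eval_map, ← Polynomial.eval_map, hz,
    zero_pow (pow_pos (expChar_pos K p) e).ne'] at h1
  rw [← h1]
  congr 2
  refine MvPolynomial.ringHom_ext (fun c => ?_) fun i => ?_ <;> simp [ha]

theorem exists_map_eval_separable {φ : Polynomial (MvPolynomial σ K)} (hm : φ.Monic)
    (hirr : Irreducible φ) (hder : Polynomial.derivative φ ≠ 0) :
    ∃ s : MvPolynomial σ K, s ≠ 0 ∧ ∀ a, eval a s ≠ 0 → (φ.map (eval a)).Separable := by
  have hdvd : ¬ φ ∣ Polynomial.derivative φ := fun h =>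
    (Polynomial.degree_derivative_lt hm.ne_zero).not_ge (Polynomial.degree_le_of_dvd h hder)
  obtain ⟨u, w, s, hs, e⟩ := exists_bezout_of_irreducible hm hirr hdvd
  refine ⟨s, hs, fun a ha => ?_⟩
  have h1 := congrArg (Polynomial.map (eval a)) e
  simp only [Polynomial.map_add, Polynomial.map_mul, Polynomial.map_C] at h1
  refine ⟨Polynomial.C (eval a s)⁻¹ * u.map (eval a),
    Polynomial.C (eval a s)⁻¹ * w.map (eval a), ?_⟩
  rw [Polynomial.derivative_map]
  have h2 : (Polynomial.C (eval a s)⁻¹ * Polynomial.C (eval a s) : Polynomial K) = 1 := by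
    rw [← Polynomial.C_mul, inv_mul_cancel₀ ha, Polynomial.C_1]
  linear_combination Polynomial.C (eval a s)⁻¹ * h1 + h2

theorem eq_zero_of_sum_of_mul_root_pow_eq_zero {A : Type*} [CommRing A] {φ : Polynomial A}
    (hm : φ.Monic) (g : Fin φ.natDegree → A)
    (h : ∑ i, AdjoinRoot.of φ (g i) * AdjoinRoot.root φ ^ (i : ℕ) = 0) : g = 0 := by
  classical
  set P : Polynomial A := ∑ i, Polynomial.C (g i) * Polynomial.X ^ (i : ℕ) with hP
  have h1 : φ ∣ P := by
    rw [← AdjoinRoot.mk_eq_zero, ← h, hP, map_sum]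
    exact Finset.sum_congr rfl fun i _ => by simp
  have h2 : P = 0 := by
    by_contra hne
    have hD : 0 < φ.natDegree := by
      by_contra! h0
      have : IsEmpty (Fin φ.natDegree) := ⟨fun i => by have := i.2; omega⟩
      exact hne (by simp [hP])
    refine hm.not_dvd_of_natDegree_lt hne ?_ h1
    have : P.natDegree ≤ φ.natDegree - 1 := by
      refine Polynomial.natDegree_sum_le_of_forall_le _ _ fun j _ => ?_
      exact (Polynomial.natDegree_C_mul_X_pow_le _ _).trans (by omega)
    omega
  funext i
  have h3 := congrArg (fun f => Polynomial.coeff f i) h2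
  simpa [hP, Polynomial.finsetSum_coeff, Polynomial.coeff_C_mul_X_pow, Fin.val_inj] using h3

theorem exists_rational_point [IsAlgClosed K] (p : ℕ) [hp : Fact p.Prime] [CharP K p] {n : ℕ}
    (hn : 0 < n) {φ : Polynomial (MvPolynomial (Fin 2) K)} (hm : φ.Monic) (hirr : Irreducible φ)
    (hφ : ∀ t, φ.map (MvPolynomial.map (iterateFrobenius K p (n * t))) = φ)
    (hder : Polynomial.derivative φ ≠ 0) {Δ : MvPolynomial (Fin 2) K} (hΔ : Δ ≠ 0) :
    ∃ m₀ : ℕ, ∀ m ≥ m₀, ∃ (a : Fin 2 → K) (z : K), (∀ i, a i ^ p ^ (n * m) = a i) ∧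
      z ^ p ^ (n * m) = z ∧ (φ.map (eval a)).eval z = 0 ∧ eval a Δ ≠ 0 := by
  classical
  set D := φ.natDegree with hDdef
  have hD : 0 < D := hm.natDegree_pos_of_not_isUnit hirr.not_isUnit
  obtain ⟨c, hc⟩ : ∃ c, ∀ i l, degreeOf i (φ.coeff l) ≤ c := by
    refine ⟨Finset.univ.sup fun i => (Finset.range (D + 1)).sup fun l => degreeOf i (φ.coeff l),
      fun i l => ?_⟩
    rcases le_or_gt l D with h | h
    · exact (Finset.le_sup (f := fun l => degreeOf i (φ.coeff l))
        (Finset.mem_range.2 (Nat.lt_succ_of_le h))).trans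
        (Finset.le_sup (f := fun i => (Finset.range (D + 1)).sup fun l => degreeOf i (φ.coeff l))
          (Finset.mem_univ i))
    · rw [Polynomial.coeff_eq_zero_of_natDegree_lt h, degreeOf_zero]
      exact Nat.zero_le _
  obtain ⟨s, hs⟩ : ∃ s, 2 * (c * D) * D < p ^ (n * s) := by
    refine ⟨2 * (c * D) * D, (Nat.lt_pow_self hp.out.one_lt).trans_le
      (Nat.pow_le_pow_right hp.out.pos (Nat.le_mul_of_pos_left _ hn))⟩
  set M := p ^ (n * s) with hM
  have hMpos : 0 < M := pow_pos hp.out.pos _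
  have hcM : c * D ≤ M := by nlinarith
  obtain ⟨N, hN⟩ := Nat.exists_eq_add_of_le hcM
  obtain ⟨r, hr0, hr⟩ := exists_relation_of_distinct_roots p hm hirr (n * s) N (by
    rw [← hM, ← hDdef, Fintype.card_fin, hN]
    obtain ⟨D', hD'⟩ : ∃ D', D = D' + 1 := ⟨D - 1, by omega⟩
    have : 2 * (c * D) * D < c * D + N := hN ▸ hs
    rw [hD'] at this ⊢
    simp only [Nat.add_sub_cancel]
    rw [mul_assoc, mul_assoc]
    refine Nat.mul_lt_mul_of_pos_left ?_ D'.succ_pos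
    generalize c * (D' + 1) = u at this ⊢
    have h1 := Nat.mul_lt_mul_of_pos_right this (this.pos)
    zify at h1 ⊢
    nlinarith [mul_nonneg (Nat.cast_nonneg (α := ℤ) D') (sq_nonneg (u : ℤ)), sq_nonneg (u : ℤ)])
  obtain ⟨Δ', hΔ', hsep⟩ := exists_map_eval_separable hm hirr hder
  let x : (Fin 2 → Fin N) → (Fin 2 →₀ ℕ) := fun v => Finsupp.equivFunOnFinite.symm fun i => v i
  have hx : Function.Injective x := fun v w h => by
    funext i
    exact Fin.ext (DFunLike.congr_fun h i)
  let S : (Fin 2 → Fin N) → ℕ → AdjoinRoot φ := fun v j => if hj : j < D then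
    ∑ i : Fin D, AdjoinRoot.of φ (r (v, i, ⟨j, hj⟩)) * AdjoinRoot.root φ ^ (i : ℕ) else 0
  obtain ⟨v₀, j₀, hS⟩ : ∃ v, ∃ j : Fin D, S v j ≠ 0 := by
    by_contra! h
    refine hr0 (funext fun ⟨v, i, j⟩ => ?_)
    have h1 := (dif_pos j.2).symm.trans (h v j)
    exact congrFun (eq_zero_of_sum_of_mul_root_pow_eq_zero hm _ h1) i
  have : Nonempty (Fin 2 → Fin N) := ⟨v₀⟩
  obtain ⟨Q₀, hQ₀⟩ := sum_mul_pow_ne_zero hm hirr (Finset.univ.image x)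
    (fun v j => S (Function.invFun x v) j) (Finset.mem_image_of_mem x (Finset.mem_univ v₀)) j₀.2
    (by rwa [Function.leftInverse_invFun hx])
  have hF : ∀ Q, ∑ j ∈ Finset.range D, (∑ v ∈ Finset.univ.image x, S (Function.invFun x v) j *
      AdjoinRoot.of φ (monomial (Q • v) 1)) * AdjoinRoot.root φ ^ (Q * j) =
      ∑ y : (Fin 2 → Fin N) × Fin D × Fin D, AdjoinRoot.of φ (r y * monomial (Q • x y.1) 1) *
        AdjoinRoot.root φ ^ ((y.2.1 : ℕ) + Q * y.2.2) := by
    intro Q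
    simp only [Finset.sum_image hx.injOn, Function.leftInverse_invFun hx _, Fintype.sum_prod_type]
    rw [Finset.sum_range]
    simp only [S, Fin.is_lt, dif_pos, Finset.sum_mul]
    rw [Finset.sum_comm]
    refine Finset.sum_congr rfl fun v _ => ?_
    rw [Finset.sum_comm]
    refine Finset.sum_congr rfl fun i _ => Finset.sum_congr rfl fun j _ => ?_
    rw [map_mul, pow_add]
    ring
  obtain ⟨c₁, hc₁⟩ : ∃ c₁, ∀ i, (∀ y, degreeOf i (r y) ≤ c₁) := by
    refine ⟨Finset.univ.sup fun i => Finset.univ.sup fun y => degreeOf i (r y), fun i y => ?_⟩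
    exact (Finset.le_sup (f := fun y => degreeOf i (r y)) (Finset.mem_univ y)).trans
      (Finset.le_sup (f := fun i => Finset.univ.sup fun y => degreeOf i (r y)) (Finset.mem_univ i))
  obtain ⟨c₂, hc₂⟩ : ∃ c₂, ∀ i, degreeOf i (Δ * Δ') ≤ c₂ :=
    ⟨Finset.univ.sup fun i => degreeOf i (Δ * Δ'), fun i =>
      Finset.le_sup (f := fun i => degreeOf i (Δ * Δ')) (Finset.mem_univ i)⟩
  refine ⟨s + (Q₀ + c₁ + c * D + c₂ + 1), fun m hmm => ?_⟩
  obtain ⟨t, rfl⟩ := Nat.exists_eq_add_of_le (le_of_add_le_left hmm)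
  have ht : Q₀ + c₁ + c * D + c₂ + 1 ≤ t := by omega
  set Q := p ^ (n * t) with hQ
  have hQt : t ≤ Q := (Nat.lt_pow_self hp.out.one_lt).le.trans
      (Nat.pow_le_pow_right hp.out.pos (Nat.le_mul_of_pos_left _ hn))
  have hQM : p ^ (n * (s + t)) = Q * M := by rw [mul_add, pow_add, mul_comm]
  by_contra! hno
  have : Nontrivial (AdjoinRoot φ) := AdjoinRoot.nontrivial _ (by
    rw [Polynomial.degree_eq_natDegree hm.ne_zero]; exact_mod_cast hD.ne')
  have : ExpChar (AdjoinRoot φ) p :=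
    expChar_of_injective_ringHom ((AdjoinRoot.of φ).comp C).injective p
  refine hQ₀ Q (by omega) ?_ ?_
  · rw [eval₂_pow_of_map_iterateFrobenius_eq p (hφ t) (AdjoinRoot.of φ),
      AdjoinRoot.eval₂_root, zero_pow (pow_pos hp.out.pos _).ne']
  rw [← hDdef, hF]
  refine eq_zero_of_rootCoord_eq_zero hm fun l hl => ?_
  refine (mul_eq_zero.1 ?_).resolve_right (mul_ne_zero hΔ hΔ')
  obtain ⟨G, hGcard, hG⟩ := exists_finset_pow_eq_self (K := K) p (e := n * (s + t)) (by
    have : 0 < s + t := by omega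
    positivity)
  refine MvPolynomial.eq_zero_of_eval_zero_at_prod_finset _ (fun _ => G) (fun i => ?_) ?_
  · rw [hGcard, hQM]
    have h1 := degreeOf_rootCoord_sum_le hm hD (hc i) Finset.univ
      (fun y : (Fin 2 → Fin N) × Fin D × Fin D => r y * monomial (Q • x y.1) 1)
      (fun y => (y.2.1 : ℕ) + Q * y.2.2) (B := c₁ + Q * (N - 1) + c * (D + Q * (D - 1)))
      (fun y _ => by
        have h1 := degreeOf_mul_le i (r y) (monomial (Q • x y.1) (1 : K))
        rw [degreeOf_monomial_eq _ _ one_ne_zero] at h1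
        have h2 : (Q • x y.1) i ≤ Q * (N - 1) := Nat.mul_le_mul_left _ (by
          have := (y.1 i).2
          change (y.1 i : ℕ) ≤ N - 1
          omega)
        have h3 : c * ((y.2.1 : ℕ) + Q * y.2.2) ≤ c * (D + Q * (D - 1)) :=
          Nat.mul_le_mul_left _ (add_le_add y.2.1.2.le (Nat.mul_le_mul_left _ (by
            have := y.2.2.2
            omega)))
        have h4 := hc₁ i y
        omega) l
    have h2 := degreeOf_mul_le i (rootCoord hm l (∑ y : (Fin 2 → Fin N) × Fin D × Fin D,
      AdjoinRoot.of φ (r y * monomial (Q • x y.1) 1) *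
        AdjoinRoot.root φ ^ ((y.2.1 : ℕ) + Q * y.2.2))) (Δ * Δ')
    have h3 := hc₂ i
    have hN0 : 0 < N := (v₀ 0).pos
    obtain ⟨D', hD'⟩ : ∃ D', D = D' + 1 := ⟨D - 1, by omega⟩
    obtain ⟨N', rfl⟩ : ∃ N', N = N' + 1 := ⟨N - 1, by omega⟩
    rw [hN]
    refine h2.trans_lt (lt_of_le_of_lt (add_le_add h1 h3) ?_)
    rw [hD'] at ht ⊢
    simp only [Nat.add_sub_cancel]
    nlinarith [Nat.zero_le (Q * c)]
  · intro a ha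
    rw [map_mul]
    by_cases hd : eval a (Δ * Δ') = 0
    · rw [hd, mul_zero]
    rw [map_mul, mul_eq_zero, not_or] at hd
    have ha' : ∀ i, a i ^ p ^ (n * (s + t)) = a i := fun i => (hG _).1 (ha i)
    rw [eval_rootCoord_eq_zero hm hD (hsep a hd.2) (fun z hz => ?_) hl, zero_mul]
    have hz' := map_eval_pow_eq p (hφ (s + t)) a z hz ha'
    have hne : z ≠ z ^ p ^ (n * (s + t)) := fun h => hd.1 (hno a z ha' h.symm hz)
    refine pow_eq_zero_iff hMpos.ne' |>.1 ?_
    rw [← hr a z _ hz hz' hne, map_sum, hM, sum_pow_char_pow]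
    refine Finset.sum_congr rfl fun y _ => ?_
    rw [← hM, hQM]
    have h1 : eval a (monomial (Q • x y.1) 1) ^ M = ∏ i, a i ^ (y.1 i : ℕ) := by
      rw [eval_monomial, one_mul, Finsupp.prod_fintype _ _ (by simp), ← Finset.prod_pow]
      refine Finset.prod_congr rfl fun i _ => ?_
      change (a i ^ (Q * (y.1 i : ℕ))) ^ M = _
      rw [← pow_mul, mul_right_comm, ← hQM, pow_mul, ha']
    rw [map_mul, map_pow, fibrePoint_of, fibrePoint_root, map_mul, mul_pow, mul_pow, h1]
    ring

end SurfacePoints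

theorem odd_of_modEq_two {a b : ℕ} (h : a ≡ b [MOD 2]) (hb : Odd b) : Odd a := by
  rw [Nat.odd_iff] at hb ⊢
  exact Eq.trans h hb

theorem choose_two_mul_mod_two (a b : ℕ) : (2 * a).choose (2 * b) ≡ a.choose b [MOD 2] := by
  have := Choose.choose_modEq_choose_mod_mul_choose_div_nat (n := 2 * a) (k := 2 * b) (p := 2)
  simpa using this

theorem choose_two_mul_add_one_mod_two (a b : ℕ) :
    (2 * a + 1).choose (2 * b + 1) ≡ a.choose b [MOD 2] := by
  have := Choose.choose_modEq_choose_mod_mul_choose_div_nat (n := 2 * a + 1) (k := 2 * b + 1)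
    (p := 2)
  rwa [show (2 * a + 1) % 2 = 1 by omega, show (2 * b + 1) % 2 = 1 by omega,
    show (2 * a + 1) / 2 = a by omega, show (2 * b + 1) / 2 = b by omega, Nat.choose_self,
    one_mul] at this

theorem choose_two_mul_add_one_two_mul_mod_two (a b : ℕ) :
    (2 * a + 1).choose (2 * b) ≡ a.choose b [MOD 2] := by
  have := Choose.choose_modEq_choose_mod_mul_choose_div_nat (n := 2 * a + 1) (k := 2 * b)
    (p := 2)
  rwa [show (2 * a + 1) % 2 = 1 by omega, show (2 * b) % 2 = 0 by omega,
    show (2 * a + 1) / 2 = a by omega, show (2 * b) / 2 = b by omega, Nat.choose_zero_right,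
    one_mul] at this

theorem choose_two_pow_mul_mod_two (i a b : ℕ) :
    (2 ^ i * a).choose (2 ^ i * b) ≡ a.choose b [MOD 2] := by
  induction i with
  | zero => simpa using Nat.ModEq.refl _
  | succ i ih =>
    rw [pow_succ', mul_assoc, mul_assoc]
    exact (choose_two_mul_mod_two _ _).trans ih

theorem choose_two_pow_mul_add_one_mod_two {i : ℕ} (hi : i ≠ 0) (a b : ℕ) :
    (2 ^ i * a + 1).choose (2 ^ i * b + 1) ≡ a.choose b [MOD 2] := by
  obtain ⟨i, rfl⟩ := Nat.exists_eq_succ_of_ne_zero hi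
  rw [pow_succ', mul_assoc, mul_assoc]
  exact (choose_two_mul_add_one_mod_two _ _).trans (choose_two_pow_mul_mod_two _ _ _)

theorem choose_two_pow_mul_add_one_two_pow_mul_mod_two {i : ℕ} (hi : i ≠ 0) (a b : ℕ) :
    (2 ^ i * a + 1).choose (2 ^ i * b) ≡ a.choose b [MOD 2] := by
  obtain ⟨i, rfl⟩ := Nat.exists_eq_succ_of_ne_zero hi
  rw [pow_succ', mul_assoc, mul_assoc]
  exact (choose_two_mul_add_one_two_mul_mod_two _ _).trans (choose_two_pow_mul_mod_two _ _ _)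

/-- `x ^ j + (x + 1) ^ j + (x + a) ^ j + (x + 1 + a) ^ j` as a polynomial in `x`. -/
noncomputable def sumPow {R : Type*} [CommRing R] (a : R) (j : ℕ) : Polynomial R :=
  Polynomial.X ^ j + (Polynomial.X + 1) ^ j + (Polynomial.X + Polynomial.C a) ^ j +
    (Polynomial.X + 1 + Polynomial.C a) ^ j

theorem map_sumPow {R S : Type*} [CommRing R] [CommRing S] (g : R →+* S) (a : R) (j : ℕ) :
    (sumPow a j).map g = sumPow (g a) j := by
  simp [sumPow]

theorem coeff_sumPow {R : Type*} [CommRing R] (a : R) {j m : ℕ} (hj : j ≠ 0) (hjm : j ≤ m) :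
    (sumPow a m).coeff (m - j) = m.choose j * (1 + a ^ j + (1 + a) ^ j) := by
  have h1 : (Polynomial.X + 1 : Polynomial R) = Polynomial.X + Polynomial.C 1 := by simp
  have h2 : (Polynomial.X + 1 + Polynomial.C a : Polynomial R) =
      Polynomial.X + Polynomial.C (1 + a) := by simp [add_assoc]
  rw [sumPow, h2, h1]
  simp only [Polynomial.coeff_add, Polynomial.coeff_X_add_C_pow, Polynomial.coeff_X_pow,
    Nat.sub_sub_self hjm, Nat.choose_symm hjm, one_pow]
  rw [if_neg (by omega)]
  ring

theorem sumPow_two_pow_add_one {R : Type*} [CommRing R] [CharP R 2] (a : R) (k : ℕ) :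
    sumPow a (2 ^ k + 1) = Polynomial.C (a ^ 2 ^ k + a) := by
  have h2 : (2 : Polynomial R) = 0 := CharTwo.two_eq_zero
  simp only [sumPow, pow_succ _ (2 ^ k), add_pow_char_pow, one_pow, Polynomial.C_add,
    Polynomial.C_pow]
  set x := (Polynomial.X : Polynomial R)
  set b := (Polynomial.C a : Polynomial R)
  linear_combination (2 * x ^ 2 ^ k * x + x + x ^ 2 ^ k + 1 + x * b ^ 2 ^ k + b * x ^ 2 ^ k
    + b * b ^ 2 ^ k) * h2

section CharTwo

variable {K : Type*} [Field K] [CharP K 2]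

theorem natCast_eq_one_of_odd {R : Type*} [Ring R] [CharP R 2] {n : ℕ} (h : Odd n) :
    (n : R) = 1 := by
  obtain ⟨m, rfl⟩ := h
  simp [CharTwo.two_eq_zero]

theorem pow_two_pow_gcd_eq_self {a : K} {i k : ℕ} (hi : a ^ 2 ^ i = a) (hk : a ^ 2 ^ k = a) :
    a ^ 2 ^ Nat.gcd i k = a := by
  have h1 : Function.IsPeriodicPt (frobenius K 2) i a := by
    rw [Function.IsPeriodicPt, Function.IsFixedPt, iterate_frobenius, hi]
  have h2 : Function.IsPeriodicPt (frobenius K 2) k a := by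
    rw [Function.IsPeriodicPt, Function.IsFixedPt, iterate_frobenius, hk]
  have h3 := h1.gcd h2
  rwa [Function.IsPeriodicPt, Function.IsFixedPt, iterate_frobenius] at h3

theorem coeff_sumPow_two_pow_add_one (a : K) {j d : ℕ} (hjd : 2 ^ j + 1 ≤ d)
    (hodd : Odd (d.choose (2 ^ j + 1))) :
    (sumPow a d).coeff (d - (2 ^ j + 1)) = a ^ 2 ^ j + a := by
  have h2 : (2 : K) = 0 := CharTwo.two_eq_zero
  rw [coeff_sumPow a (Nat.succ_ne_zero _) hjd, natCast_eq_one_of_odd hodd, pow_succ, pow_succ,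
    add_pow_char_pow, one_pow]
  linear_combination (1 + a ^ 2 ^ j * a) * h2

theorem sumPow_ne_zero {a : K} {i k l : ℕ} (hi : i ≠ 0) (hl : Odd l) (hak : a ^ 2 ^ k = a)
    (ha0 : a ≠ 0) (ha1 : a ≠ 1) (hexc : l = 1 → Nat.gcd i k = 1) :
    sumPow a (2 ^ i * l + 1) ≠ 0 := by
  intro h0
  have h2 : (2 : K) = 0 := CharTwo.two_eq_zero
  have hpos : ∀ n, 0 < 2 ^ n := fun n => pow_pos two_pos n
  have haa : a ^ 2 + a ≠ 0 := by
    have : a ^ 2 + a = a * (a - 1) := by linear_combination a * h2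
    rw [this]
    exact mul_ne_zero ha0 (sub_ne_zero.2 ha1)
  have key : ∀ j, 2 ^ j + 1 ≤ 2 ^ i * l + 1 → Odd ((2 ^ i * l + 1).choose (2 ^ j + 1)) →
      a ^ 2 ^ j = a := fun j hj ho => by
    have := coeff_sumPow_two_pow_add_one a hj ho
    rw [h0, Polynomial.coeff_zero] at this
    linear_combination -this - a * h2
  have hai : a ^ 2 ^ i = a := by
    refine key i (by nlinarith [hl.pos, hpos i]) ?_
    have := choose_two_pow_mul_add_one_mod_two hi l 1
    rw [mul_one, Nat.choose_one_right] at this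
    exact odd_of_modEq_two this hl
  rcases eq_or_ne l 1 with rfl | hl1
  · have := pow_two_pow_gcd_eq_self hai hak
    rw [hexc rfl, pow_one] at this
    exact haa (by linear_combination this + a * h2)
  · obtain ⟨c, l', hl', hc⟩ := Nat.exists_eq_two_pow_mul_odd (n := l - 1) (by have := hl.pos; omega)
    have hc0 : c ≠ 0 := by
      rintro rfl
      rw [pow_zero, one_mul] at hc
      rw [Nat.odd_iff] at hl hl'
      omega
    obtain rfl : l = 2 ^ c * l' + 1 := by have := hl.pos; omega
    have haic : a ^ 2 ^ (i + c) = a := by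
      refine key (i + c) ?_ ?_
      · rw [pow_add]
        nlinarith [hl'.pos, hpos i, hpos c, Nat.mul_le_mul_left (2 ^ i * 2 ^ c) hl'.pos]
      · have := (choose_two_pow_mul_add_one_mod_two hi (2 ^ c * l' + 1) (2 ^ c * 1)).trans
          (choose_two_pow_mul_add_one_two_pow_mul_mod_two hc0 l' 1)
        rw [Nat.choose_one_right, mul_one, ← pow_add] at this
        exact odd_of_modEq_two this hl'
    have h3 := (choose_two_pow_mul_add_one_mod_two hi (2 ^ c * l' + 1) (2 ^ c * 1 + 1)).trans
          (choose_two_pow_mul_add_one_mod_two hc0 l' 1)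
    rw [Nat.choose_one_right, mul_one] at h3
    have h4 := coeff_sumPow a (j := 2 ^ i * (2 ^ c + 1) + 1) (m := 2 ^ i * (2 ^ c * l' + 1) + 1)
      (by omega) (by
        have := Nat.mul_le_mul_left (2 ^ c) hl'.pos
        gcongr
        omega)
    have hb : ∀ b : K, b ^ 2 ^ i = b → b ^ 2 ^ (i + c) = b →
        b ^ (2 ^ i * (2 ^ c + 1) + 1) = b ^ 3 := fun b h1 h2 => by
      rw [mul_add, ← pow_add, mul_one, pow_succ, pow_add, h1, h2]
      ring
    rw [h0, Polynomial.coeff_zero, natCast_eq_one_of_odd (odd_of_modEq_two h3 hl'), hb a hai haic,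
      hb (1 + a) (by rw [add_pow_char_pow, one_pow, hai])
        (by rw [add_pow_char_pow, one_pow, haic])] at h4
    exact haa (by linear_combination -h4 - (1 + a + a ^ 2 + a ^ 3) * h2)

theorem exists_pow_eq_self_and_pow_ne_self [IsAlgClosed K] {i k : ℕ} (hi : i ≠ 0) (hik : i < k) :
    ∃ a : K, a ^ 2 ^ k = a ∧ a ^ 2 ^ i ≠ a := by
  have : Fact (Nat.Prime 2) := ⟨Nat.prime_two⟩
  obtain ⟨S, hS, hS'⟩ := exists_finset_pow_eq_self (K := K) 2 hi
  obtain ⟨T, hT, hT'⟩ := exists_finset_pow_eq_self (K := K) 2 (e := k) (by omega)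
  by_contra! h
  have h1 : T ⊆ S := fun a ha => (hS' a).2 (h a ((hT' a).1 ha))
  have h2 := Finset.card_le_card h1
  rw [hS, hT] at h2
  exact absurd h2 (not_le.2 (Nat.pow_lt_pow_right one_lt_two hik))

/-- If the leading coefficient of `A` vanishes at `α` and that of `B` does not, the degree of
`sumPow α d` is bounded. -/
theorem natDegree_sumPow_add_le {A B : Polynomial (Polynomial (Polynomial K))} {F : Polynomial K}
    {k d : ℕ} (hA : ∀ r, (A.coeff r).natDegree ≤ r)
    (hF : ∀ r, d < r → r ≠ 2 ^ k + 1 → F.coeff r = 0) (hFd : F.coeff d ≠ 0) (hd3 : 3 ≤ d)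
    (hAB : ∀ r, Polynomial.C (Polynomial.X * (Polynomial.X + 1)) * (A * B).coeff r =
      Polynomial.C (Polynomial.C (F.coeff (r + 3))) * sumPow Polynomial.X (r + 3))
    {gB : Polynomial K} (hgB : B.leadingCoeff = Polynomial.C gB) {a : K} (hak : a ^ 2 ^ k = a)
    (ha0 : a ≠ 0) (ha1 : a ≠ 1) (hB : gB.eval a ≠ 0) (hne : sumPow a d ≠ 0) :
    B.natDegree + (sumPow a d).natDegree ≤ d - 3 := by
  have h2 : (2 : K) = 0 := CharTwo.two_eq_zero
  set σ : Polynomial (Polynomial K) →+* Polynomial K :=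
    Polynomial.mapRingHom (Polynomial.evalRingHom a) with hσ
  have hu : a * (a + 1) ≠ 0 := mul_ne_zero ha0 fun h => ha1 (by linear_combination h - h2)
  have hB' : (B.map σ).natDegree = B.natDegree :=
    Polynomial.natDegree_map_of_leadingCoeff_ne_zero σ (by simpa [hgB, hσ] using hB)
  have hBlc : (B.map σ).leadingCoeff = Polynomial.C (gB.eval a) := by
    rw [Polynomial.leadingCoeff, hB', Polynomial.coeff_map, Polynomial.coeff_natDegree, hgB]
    simp [hσ]
  have hAB' : ∀ r, Polynomial.C (a * (a + 1)) * (A.map σ * B.map σ).coeff r =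
      Polynomial.C (F.coeff (r + 3)) * sumPow a (r + 3) := fun r => by
    have h1 := congrArg σ (hAB r)
    rw [map_mul, map_mul, ← Polynomial.coeff_map, Polynomial.map_mul] at h1
    simpa [hσ, map_sumPow] using h1
  have hzero : ∀ r, d - 3 < r → (A.map σ * B.map σ).coeff r = 0 := fun r hr => by
    have h1 := hAB' r
    have h3 : Polynomial.C (F.coeff (r + 3)) * sumPow a (r + 3) = 0 := by
      by_cases hq : r + 3 = 2 ^ k + 1
      · rw [hq, sumPow_two_pow_add_one, hak]
        simp [CharTwo.add_self_eq_zero]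
      · rw [hF _ (by omega) hq]
        simp
    rw [h3] at h1
    exact (mul_eq_zero.1 h1).resolve_left (Polynomial.C_ne_zero.2 hu)
  have hlead := hAB' (d - 3)
  rw [Nat.sub_add_cancel hd3] at hlead
  have hne0 : (A.map σ * B.map σ).coeff (d - 3) ≠ 0 := fun h => by
    rw [h, mul_zero] at hlead
    exact mul_ne_zero (Polynomial.C_ne_zero.2 hFd) hne hlead.symm
  have hdeg : (A.map σ * B.map σ).natDegree = d - 3 :=
    Polynomial.natDegree_eq_of_le_of_coeff_ne_zero
      (Polynomial.natDegree_le_iff_coeff_eq_zero.2 hzero) hne0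
  have hAB0 : A.map σ * B.map σ ≠ 0 := fun h => hne0 (by rw [h, Polynomial.coeff_zero])
  rw [Polynomial.natDegree_mul (left_ne_zero_of_mul hAB0) (right_ne_zero_of_mul hAB0), hB'] at hdeg
  rw [← hdeg, ← hB', Polynomial.coeff_mul_degree_add_degree, hBlc] at hlead
  have h3 := congrArg Polynomial.natDegree hlead
  rw [Polynomial.natDegree_C_mul hu, Polynomial.natDegree_mul_C hB,
    Polynomial.natDegree_C_mul hFd, Polynomial.leadingCoeff,
    Polynomial.coeff_map] at h3
  have h4 := (Polynomial.natDegree_map_le (f := Polynomial.evalRingHom a)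
    (p := A.coeff (A.map σ).natDegree)).trans (hA _)
  rw [← Polynomial.coe_mapRingHom, ← hσ, h3] at h4
  omega

theorem natDegree_eq_zero_or [IsAlgClosed K] {A B : Polynomial (Polynomial (Polynomial K))}
    {F : Polynomial K} {k d : ℕ}
    (hA : ∀ r, (A.coeff r).natDegree ≤ r) (hA' : ∀ r i, ((A.coeff r).coeff i).natDegree ≤ r)
    (hB : ∀ r, (B.coeff r).natDegree ≤ r) (hB' : ∀ r i, ((B.coeff r).coeff i).natDegree ≤ r)
    (hk : 2 ≤ k) (hd : Odd d) (hd3 : 3 ≤ d) (hdk : d < 2 ^ k + 1)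
    (hexc : ∀ l, d = 2 ^ l + 1 → Nat.gcd l k = 1)
    (hFk : F.coeff (2 ^ k + 1) = 1) (hF : ∀ r, d < r → r ≠ 2 ^ k + 1 → F.coeff r = 0)
    (hFd : F.coeff d ≠ 0)
    (hAB : ∀ r, Polynomial.C (Polynomial.X * (Polynomial.X + 1)) * (A * B).coeff r =
      Polynomial.C (Polynomial.C (F.coeff (r + 3))) * sumPow Polynomial.X (r + 3)) :
    A.natDegree = 0 ∨ B.natDegree = 0 := by
  have h2 : (2 : K) = 0 := CharTwo.two_eq_zero
  by_contra! hcon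
  obtain ⟨hs, ht⟩ := hcon
  have hq : 4 ≤ 2 ^ k := by
    calc 4 = 2 ^ 2 := by norm_num
      _ ≤ 2 ^ k := Nat.pow_le_pow_right two_pos hk
  have hX : (Polynomial.X ^ 2 ^ k + Polynomial.X : Polynomial K).natDegree = 2 ^ k := by
    rw [Polynomial.natDegree_add_eq_left_of_natDegree_lt, Polynomial.natDegree_X_pow]
    rw [Polynomial.natDegree_X_pow, Polynomial.natDegree_X]
    omega
  have hX0 : (Polynomial.X ^ 2 ^ k + Polynomial.X : Polynomial K) ≠ 0 := fun h => by
    rw [h, Polynomial.natDegree_zero] at hX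
    omega
  have hU : (Polynomial.X * (Polynomial.X + 1) : Polynomial K) ≠ 0 := by
    rw [← Polynomial.C_1]
    exact mul_ne_zero Polynomial.X_ne_zero (Polynomial.X_add_C_ne_zero 1)
  have hlead := hAB (2 ^ k - 2)
  rw [show 2 ^ k - 2 + 3 = 2 ^ k + 1 by omega, hFk, sumPow_two_pow_add_one] at hlead
  simp only [Polynomial.C_1, one_mul] at hlead
  have hne0 : (A * B).coeff (2 ^ k - 2) ≠ 0 := fun h => by
    rw [h, mul_zero] at hlead
    exact Polynomial.C_ne_zero.2 hX0 hlead.symm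
  have hdeg : (A * B).natDegree = 2 ^ k - 2 := by
    refine Polynomial.natDegree_eq_of_le_of_coeff_ne_zero
      (Polynomial.natDegree_le_iff_coeff_eq_zero.2 fun r hr => ?_) hne0
    have h1 := hAB r
    rw [hF (r + 3) (by omega) (by omega)] at h1
    simp only [Polynomial.C_0, zero_mul] at h1
    exact (mul_eq_zero.1 h1).resolve_left (Polynomial.C_ne_zero.2 hU)
  have hAB0 : A * B ≠ 0 := fun h => hne0 (by rw [h, Polynomial.coeff_zero])
  rw [Polynomial.natDegree_mul (left_ne_zero_of_mul hAB0) (right_ne_zero_of_mul hAB0)] at hdeg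
  rw [← hdeg, Polynomial.coeff_mul_degree_add_degree] at hlead
  have hlA : A.leadingCoeff ≠ 0 := Polynomial.leadingCoeff_ne_zero.2 (left_ne_zero_of_mul hAB0)
  have hlB : B.leadingCoeff ≠ 0 := Polynomial.leadingCoeff_ne_zero.2 (right_ne_zero_of_mul hAB0)
  have hx := congrArg Polynomial.natDegree hlead
  rw [Polynomial.natDegree_C_mul hU, Polynomial.natDegree_mul hlA hlB,
    Polynomial.natDegree_C] at hx
  obtain ⟨gA, hgA⟩ := Polynomial.natDegree_eq_zero.1 (show A.leadingCoeff.natDegree = 0 by omega)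
  obtain ⟨gB, hgB⟩ := Polynomial.natDegree_eq_zero.1 (show B.leadingCoeff.natDegree = 0 by omega)
  have hgA0 : gA ≠ 0 := by rintro rfl; exact hlA (by simp [← hgA])
  have hgB0 : gB ≠ 0 := by rintro rfl; exact hlB (by simp [← hgB])
  have hgAB : Polynomial.X * (Polynomial.X + 1) * (gA * gB) =
      Polynomial.X ^ 2 ^ k + Polynomial.X := by
    rw [← hgA, ← hgB, ← Polynomial.C_mul, ← Polynomial.C_mul] at hlead
    exact Polynomial.C_injective hlead
  have hgAs : gA.natDegree ≤ A.natDegree := by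
    have := hA' A.natDegree 0
    rwa [Polynomial.coeff_natDegree, ← hgA, Polynomial.coeff_C_zero] at this
  have hgBt : gB.natDegree ≤ B.natDegree := by
    have := hB' B.natDegree 0
    rwa [Polynomial.coeff_natDegree, ← hgB, Polynomial.coeff_C_zero] at this
  have hsum : 2 + (gA.natDegree + gB.natDegree) = 2 ^ k := by
    rw [← hX, ← hgAB, Polynomial.natDegree_mul hU (mul_ne_zero hgA0 hgB0),
      Polynomial.natDegree_mul hgA0 hgB0, ← Polynomial.C_1,
      Polynomial.natDegree_mul Polynomial.X_ne_zero (Polynomial.X_add_C_ne_zero 1),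
      Polynomial.natDegree_X, Polynomial.natDegree_X_add_C]
  have hroot : ∀ U V : Polynomial K, U * V = Polynomial.X ^ 2 ^ k + Polynomial.X →
      ∀ a, U.eval a = 0 → V.eval a ≠ 0 := fun U V h a hUa hVa => by
    have h1 := congrArg (fun f => (Polynomial.derivative f).eval a) h
    rw [Polynomial.derivative_mul, Polynomial.derivative_add, Polynomial.derivative_X_pow,
      Nat.cast_pow, Nat.cast_two, h2, zero_pow (by omega)] at h1
    simp [hUa, hVa] at h1
  have hfix : ∀ a : K, a ^ 2 ^ k + a = a * (a + 1) * (gA.eval a * gB.eval a) := fun a => by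
    have h1 := congrArg (Polynomial.eval a) hgAB
    simpa using h1.symm
  have hrootA : ∀ a, gA.eval a = 0 → a ^ 2 ^ k = a ∧ a ≠ 0 ∧ a ≠ 1 ∧ gB.eval a ≠ 0 := by
    refine fun a ha => ⟨?_, ?_, ?_, ?_⟩
    · have := hfix a
      rw [ha] at this
      linear_combination this - a * h2
    · rintro rfl
      exact hroot _ _ hgAB 0 (by simp) (by simp [ha])
    · rintro rfl
      exact hroot _ _ hgAB 1 (by simp [CharTwo.add_self_eq_zero]) (by simp [ha])
    · exact hroot gA (gB * (Polynomial.X * (Polynomial.X + 1))) (by rw [← hgAB]; ring) a ha ∘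
        fun h => by simp [h]
  have hrootB : ∀ a, gB.eval a = 0 → a ^ 2 ^ k = a ∧ a ≠ 0 ∧ a ≠ 1 ∧ gA.eval a ≠ 0 := by
    refine fun a ha => ⟨?_, ?_, ?_, fun h => (hrootA a h).2.2.2 ha⟩
    · have := hfix a
      rw [ha] at this
      linear_combination this - a * h2
    · rintro rfl
      exact hroot _ _ hgAB 0 (by simp) (by simp [ha])
    · rintro rfl
      exact hroot _ _ hgAB 1 (by simp [CharTwo.add_self_eq_zero]) (by simp [ha])
  obtain ⟨i, l, hl, hil⟩ := Nat.exists_eq_two_pow_mul_odd (n := d - 1) (by omega)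
  obtain rfl : d = 2 ^ i * l + 1 := by omega
  have hi0 : i ≠ 0 := by
    rintro rfl
    rw [Nat.odd_iff] at hd hl
    omega
  have hlpos := hl.pos
  have hile : 2 ^ i ≤ 2 ^ i * l := Nat.le_mul_of_pos_right _ hlpos
  have hik : i < k := (Nat.pow_lt_pow_iff_right one_lt_two).1 (by omega)
  have hne : ∀ a : K, a ^ 2 ^ k = a → a ≠ 0 → a ≠ 1 → sumPow a (2 ^ i * l + 1) ≠ 0 :=
    fun a hak ha0 ha1 => sumPow_ne_zero hi0 hl hak ha0 ha1 fun h => hexc i (by rw [h, mul_one])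
  have hbA : ∀ a, gA.eval a = 0 →
      B.natDegree + (sumPow a (2 ^ i * l + 1)).natDegree ≤ 2 ^ i * l + 1 - 3 := fun a ha => by
    obtain ⟨hak, ha0, ha1, hb⟩ := hrootA a ha
    exact natDegree_sumPow_add_le hA hF hFd hd3 hAB hgB.symm hak ha0 ha1 hb (hne a hak ha0 ha1)
  have hbB : ∀ a, gB.eval a = 0 →
      A.natDegree + (sumPow a (2 ^ i * l + 1)).natDegree ≤ 2 ^ i * l + 1 - 3 := fun a ha => by
    obtain ⟨hak, ha0, ha1, hb⟩ := hrootB a ha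
    exact natDegree_sumPow_add_le hB hF hFd hd3 (by rwa [mul_comm B A]) hgA.symm hak ha0 ha1 hb
      (hne a hak ha0 ha1)
  obtain ⟨aA, haA⟩ := IsAlgClosed.exists_root gA (by
    rw [Polynomial.degree_eq_natDegree hgA0]; exact_mod_cast (show gA.natDegree ≠ 0 by omega))
  obtain ⟨aB, haB⟩ := IsAlgClosed.exists_root gB (by
    rw [Polynomial.degree_eq_natDegree hgB0]; exact_mod_cast (show gB.natDegree ≠ 0 by omega))
  have hA1 := hbA aA haA
  have hB1 := hbB aB haB
  have hgap : 2 ^ i * l + 2 ^ i ≤ 2 ^ k := by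
    obtain ⟨c, hc⟩ := Nat.exists_eq_add_of_le hik.le
    rw [hc, pow_add] at hdk ⊢
    have : l < 2 ^ c := Nat.lt_of_mul_lt_mul_left (a := 2 ^ i) (by omega)
    calc 2 ^ i * l + 2 ^ i = 2 ^ i * (l + 1) := by ring
      _ ≤ 2 ^ i * 2 ^ c := Nat.mul_le_mul_left _ this
  obtain ⟨a, hak, hai⟩ := exists_pow_eq_self_and_pow_ne_self (K := K) hi0 hik
  have ha0 : a ≠ 0 := by rintro rfl; exact hai (by simp)
  have ha1 : a ≠ 1 := by rintro rfl; exact hai (by simp)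
  have hdegE : (sumPow a (2 ^ i * l + 1)).natDegree < 2 ^ i * l + 1 - (2 ^ i + 1) := by
    have h1 := hfix a
    rw [hak, CharTwo.add_self_eq_zero, eq_comm, mul_eq_zero, mul_eq_zero, mul_eq_zero] at h1
    rcases h1 with (h1 | h1) | h1 | h1
    · exact absurd h1 ha0
    · exact absurd (by linear_combination h1 - h2) ha1
    · have := hbA a h1
      omega
    · have := hbB a h1
      omega
  have h3 := coeff_sumPow_two_pow_add_one a (j := i) (d := 2 ^ i * l + 1) (by omega) (by
    have := choose_two_pow_mul_add_one_mod_two hi0 l 1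
    rw [mul_one, Nat.choose_one_right] at this
    exact odd_of_modEq_two this hl)
  rw [Polynomial.coeff_eq_zero_of_natDegree_lt hdegE] at h3
  exact hai (by linear_combination -h3 - a * h2)

end CharTwo

section LineCoordinates

variable {K : Type*} [Field K]

/-- The substitution `X 0 ↦ x t`, `X 1 ↦ (x + 1) t`, `X 2 ↦ (x + α) t`, with values in
`K[α][x][t]`. -/
noncomputable def toLines (K : Type*) [Field K] :
    MvPolynomial (Fin 3) K →ₐ[K] Polynomial (Polynomial (Polynomial K)) :=
  aeval fun i => (Polynomial.C (Polynomial.X + Polynomial.C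
    ((![0, 1, Polynomial.X] : Fin 3 → Polynomial K) i)) * Polynomial.X :
      Polynomial (Polynomial (Polynomial K)))

theorem toLines_C (c : K) : toLines K (C c) = Polynomial.C (Polynomial.C (Polynomial.C c)) := by
  rw [← algebraMap_eq, AlgHom.commutes]
  rfl

theorem toLines_X (i : Fin 3) : toLines K (X i) = Polynomial.C (Polynomial.X +
    Polynomial.C ((![0, 1, Polynomial.X] : Fin 3 → Polynomial K) i)) * Polynomial.X :=
  aeval_X _ _

theorem natDegree_coeff_toLines (P : MvPolynomial (Fin 3) K) (r : ℕ) :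
    ((toLines K P).coeff r).natDegree ≤ r ∧
      ∀ j, (((toLines K P).coeff r).coeff j).natDegree ≤ r := by
  induction P using MvPolynomial.induction_on generalizing r with
  | C c =>
    rw [toLines_C, Polynomial.coeff_C]
    split_ifs with h
    · simp only [Polynomial.natDegree_C, zero_le, Polynomial.coeff_C, true_and]
      intro j
      split_ifs <;> simp
    · simp
  | add p q hp hq =>
    simp only [map_add, Polynomial.coeff_add]
    exact ⟨Polynomial.natDegree_add_le_of_degree_le (hp r).1 (hq r).1,
      fun j => Polynomial.natDegree_add_le_of_degree_le ((hp r).2 j) ((hq r).2 j)⟩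
  | mul_X p i hp =>
    rw [map_mul, toLines_X, ← mul_assoc]
    cases r with
    | zero => simp
    | succ r =>
      rw [Polynomial.coeff_mul_X, Polynomial.coeff_mul_C]
      have hw : (![0, 1, Polynomial.X] i : Polynomial K).natDegree ≤ 1 := by
        fin_cases i <;> simp
      refine ⟨Polynomial.natDegree_mul_le_of_le (hp r).1 (Polynomial.natDegree_X_add_C _).le,
        fun j => ?_⟩
      rw [mul_add, Polynomial.coeff_add, Polynomial.coeff_mul_C]
      refine Polynomial.natDegree_add_le_of_degree_le ?_
        (Polynomial.natDegree_mul_le_of_le ((hp r).2 j) hw)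
      cases j with
      | zero => simp
      | succ j =>
        rw [Polynomial.coeff_mul_X]
        exact ((hp r).2 j).trans r.le_succ

theorem isUnit_of_natDegree_toLines_eq_zero [Infinite K] {P : MvPolynomial (Fin 3) K}
    (hP : P ≠ 0) (h : (toLines K P).natDegree = 0) : IsUnit P := by
  obtain ⟨c, hc⟩ : ∃ c, toLines K P = Polynomial.C (Polynomial.C (Polynomial.C c)) := by
    obtain ⟨w, hw⟩ := Polynomial.natDegree_eq_zero.1 h
    have h1 := natDegree_coeff_toLines P 0
    rw [← hw, Polynomial.coeff_C_zero] at h1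
    obtain ⟨v, rfl⟩ := Polynomial.natDegree_eq_zero.1 (Nat.le_zero.1 h1.1)
    have h2 := h1.2 0
    rw [Polynomial.coeff_C_zero] at h2
    obtain ⟨c, rfl⟩ := Polynomial.natDegree_eq_zero.1 (Nat.le_zero.1 h2)
    exact ⟨c, hw.symm⟩
  have heval : ∀ a : Fin 3 → K, a 0 - a 1 ≠ 0 → eval a P = c := fun a ha => by
    let g : Polynomial (Polynomial (Polynomial K)) →+* K :=
      Polynomial.eval₂RingHom (Polynomial.eval₂RingHom
        (Polynomial.evalRingHom ((a 2 - a 0) / (a 1 - a 0))) (a 0 / (a 1 - a 0))) (a 1 - a 0)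
    have ha' : a 1 - a 0 ≠ 0 := fun h => ha (by linear_combination -h)
    have h1 : g.comp (toLines K).toRingHom = eval a := by
      refine MvPolynomial.ringHom_ext (fun c => ?_) fun i => ?_
      · simp [g]
      · fin_cases i <;> simp [toLines_X, g] <;> field_simp <;> ring
    rw [← h1]
    simp [hc, g]
  have hPc : P = C c := by
    have h1 : (X 0 - X 1) * (P - C c) = 0 := by
      refine MvPolynomial.funext fun a => ?_
      simp only [map_mul, map_sub, eval_X, eval_C, map_zero]
      by_cases ha : a 0 - a 1 = 0
      · rw [ha, zero_mul]
      · rw [heval a ha, sub_self, mul_zero]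
    refine sub_eq_zero.1 ((mul_eq_zero.1 h1).resolve_left fun h0 => ?_)
    have := congrArg (eval (![1, 0, 0] : Fin 3 → K)) h0
    simp at this
  rw [hPc] at hP ⊢
  exact (IsUnit.mk0 c fun h => hP (by rw [h, C_0])).map C

theorem toLines_aeval (f : Polynomial K) {u : MvPolynomial (Fin 3) K}
    {v : Polynomial (Polynomial K)} (hu : toLines K u = Polynomial.C v * Polynomial.X) (r : ℕ) :
    (toLines K (Polynomial.aeval u f)).coeff r =
      Polynomial.C (Polynomial.C (f.coeff r)) * v ^ r := by
  have : toLines K (Polynomial.aeval u f) =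
      (f.map (Polynomial.C.comp Polynomial.C)).comp (Polynomial.C v * Polynomial.X) := by
    rw [Polynomial.aeval_def, ← AlgHom.coe_toRingHom, Polynomial.hom_eval₂, Polynomial.comp,
      Polynomial.eval₂_map]
    congr 1
    exact RingHom.ext fun c => (toLines K).commutes c
  rw [this, Polynomial.comp_C_mul_X_coeff, Polynomial.coeff_map]
  rfl

end LineCoordinates

theorem add_lines {R : Type*} [CommRing R] [CharP R 2] (x b t : R) :
    x * t + (x + 1) * t + (x + b) * t = (x + 1 + b) * t := by
  have h2 : (2 : R) = 0 := CharTwo.two_eq_zero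
  linear_combination x * t * h2

theorem add_mul_add_mul_add_lines {R : Type*} [CommRing R] [CharP R 2] (x b t : R) :
    (x * t + (x + 1) * t) * (x * t + (x + b) * t) * ((x + 1) * t + (x + b) * t) =
      t ^ 3 * (b * (b + 1)) := by
  have h2 : (2 : R) = 0 := CharTwo.two_eq_zero
  linear_combination x * ((2 * x) ^ 2 + 2 * (1 + b) * (2 * x) + (1 + b) ^ 2 + b) * t ^ 3 * h2

theorem coeff_toLines_of_delta3_mul_eq {K : Type} [Field K] [CharP K 2] {F : Polynomial K}
    {φ : MvPolynomial (Fin 3) K} (hφ : delta3 K * φ = phiNum F) (r : ℕ) :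
    Polynomial.C (Polynomial.X * (Polynomial.X + 1)) * (toLines K φ).coeff r =
      Polynomial.C (Polynomial.C (F.coeff (r + 3))) * sumPow Polynomial.X (r + 3) := by
  have h0 : toLines K (X 0) = Polynomial.C Polynomial.X * Polynomial.X := by simp [toLines_X]
  have h1 : toLines K (X 1) = Polynomial.C (Polynomial.X + 1) * Polynomial.X := by simp [toLines_X]
  have h3 : toLines K (X 2) = Polynomial.C (Polynomial.X + Polynomial.C Polynomial.X) *
    Polynomial.X := by simp [toLines_X]
  have h4 : toLines K (X 0 + X 1 + X 2) =
      Polynomial.C (Polynomial.X + 1 + Polynomial.C Polynomial.X) * Polynomial.X := by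
    simp only [map_add, h0, h1, h3, map_one]
    exact add_lines (R := Polynomial (Polynomial (Polynomial K))) _ _ _
  have hd : toLines K (delta3 K) =
      Polynomial.X ^ 3 * Polynomial.C (Polynomial.C (Polynomial.X * (Polynomial.X + 1))) := by
    simp only [delta3, map_mul, map_add, h0, h1, h3, map_one]
    exact add_mul_add_mul_add_lines (R := Polynomial (Polynomial (Polynomial K))) _ _ _
  have h5 := congrArg (fun p => (toLines K p).coeff (r + 3)) hφ
  beta_reduce at h5
  rw [map_mul, hd, mul_assoc, Polynomial.coeff_X_pow_mul, Polynomial.coeff_C_mul] at h5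
  rw [h5, phiNum, map_add, map_add, map_add]
  simp only [Polynomial.coeff_add]
  rw [toLines_aeval F h0, toLines_aeval F h1, toLines_aeval F h3, toLines_aeval F h4, sumPow]
  ring

theorem irreducible_of_delta3_mul_eq {K : Type} [Field K] [CharP K 2] [IsAlgClosed K]
    {F : Polynomial K} {φ : MvPolynomial (Fin 3) K} {k d : ℕ} (hφ : delta3 K * φ = phiNum F)
    (hk : 2 ≤ k) (hd : Odd d) (hd3 : 3 ≤ d) (hdk : d < 2 ^ k + 1)
    (hexc : ∀ l, d = 2 ^ l + 1 → Nat.gcd l k = 1) (hFk : F.coeff (2 ^ k + 1) = 1)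
    (hF : ∀ r, d < r → r ≠ 2 ^ k + 1 → F.coeff r = 0) (hFd : F.coeff d ≠ 0) :
    Irreducible φ := by
  have hk4 : 4 ≤ 2 ^ k := Nat.pow_le_pow_right two_pos hk
  have htop : (toLines K φ).coeff (2 ^ k - 2) ≠ 0 := fun h0 => by
    have h1 := coeff_toLines_of_delta3_mul_eq hφ (2 ^ k - 2)
    rw [h0, mul_zero, show 2 ^ k - 2 + 3 = 2 ^ k + 1 by omega, hFk, sumPow_two_pow_add_one,
      Polynomial.C_1, Polynomial.C_1, one_mul, eq_comm, Polynomial.C_eq_zero] at h1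
    have h2 := congrArg (fun p => p.coeff (2 ^ k)) h1
    simp [Polynomial.coeff_X, show 1 ≠ 2 ^ k by omega] at h2
  have hφ0 : φ ≠ 0 := fun h0 => htop (by rw [h0, map_zero, Polynomial.coeff_zero])
  refine ⟨fun hu => ?_, fun P Q hPQ => ?_⟩
  · obtain ⟨c, -, rfl⟩ := MvPolynomial.isUnit_iff_eq_C_of_isReduced.1 hu
    rw [toLines_C, Polynomial.coeff_C_of_ne_zero (by omega)] at htop
    exact htop rfl
  · subst hPQ
    have h1 := natDegree_eq_zero_or (A := toLines K P) (B := toLines K Q) (F := F)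
      (fun r => (natDegree_coeff_toLines P r).1) (fun r => (natDegree_coeff_toLines P r).2)
      (fun r => (natDegree_coeff_toLines Q r).1) (fun r => (natDegree_coeff_toLines Q r).2)
      hk hd hd3 hdk hexc hFk hF hFd
      (fun r => by rw [← map_mul]; exact coeff_toLines_of_delta3_mul_eq hφ r)
    exact h1.imp (isUnit_of_natDegree_toLines_eq_zero (left_ne_zero_of_mul hφ0))
      (isUnit_of_natDegree_toLines_eq_zero (right_ne_zero_of_mul hφ0))

theorem add_coeff_taylor_eq_zero {R : Type*} [CommRing R] [CharP R 2] (w : R)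
    {p : Polynomial R} {n : ℕ} (hp : p.natDegree ≤ n) :
    p.coeff n + (Polynomial.taylor w p).coeff n = 0 := by
  rcases hp.lt_or_eq with h | rfl
  · rw [Polynomial.coeff_eq_zero_of_natDegree_lt h, Polynomial.coeff_eq_zero_of_natDegree_lt
      (by rwa [Polynomial.natDegree_taylor]), add_zero]
  · rw [Polynomial.coeff_taylor_natDegree]
    exact CharTwo.add_self_eq_zero _

theorem monic_and_derivative_ne_zero_of_mul_eq {R : Type*} [CommRing R] [IsDomain R] [CharP R 2]
    {y z c : R} (hw : y + z ≠ 0) {Φ H : Polynomial R} {k : ℕ} (hk : 2 ≤ k)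
    (hH : H.natDegree < 2 ^ k)
    (h : (Polynomial.X + Polynomial.C y) * (Polynomial.X + Polynomial.C z) *
        Polynomial.C (y + z) * Φ =
      Polynomial.X ^ (2 ^ k + 1) + Polynomial.taylor (y + z) (Polynomial.X ^ (2 ^ k + 1)) +
        Polynomial.C c + (H + Polynomial.taylor (y + z) H)) :
    Φ.Monic ∧ Φ.natDegree = 2 ^ k - 2 ∧ Polynomial.derivative Φ ≠ 0 := by
  have hk4 : 4 ≤ 2 ^ k := Nat.pow_le_pow_right two_pos hk
  have h2 : (2 : Polynomial R) = 0 := CharTwo.two_eq_zero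
  set low : Polynomial R := Polynomial.C ((y + z) ^ 2 ^ k) * Polynomial.X +
    Polynomial.C ((y + z) ^ (2 ^ k + 1) + c) + (H + Polynomial.taylor (y + z) H) with hlow
  have hlowd : low.natDegree < 2 ^ k := by
    have h1 : (Polynomial.C ((y + z) ^ 2 ^ k) * Polynomial.X +
        Polynomial.C ((y + z) ^ (2 ^ k + 1) + c)).natDegree ≤ 1 := by compute_degree
    refine (Polynomial.natDegree_add_le _ _).trans_lt (max_lt (by omega)
      ((Polynomial.natDegree_add_le _ _).trans_lt (max_lt hH ?_)))
    rwa [Polynomial.natDegree_taylor]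
  have hm := (Polynomial.monic_X_add_C y).mul (Polynomial.monic_X_add_C z)
  have hmd : ((Polynomial.X + Polynomial.C y) * (Polynomial.X + Polynomial.C z)).natDegree = 2 := by
    rw [(Polynomial.monic_X_add_C y).natDegree_mul (Polynomial.monic_X_add_C z)]
    simp
  set N := (Polynomial.X + Polynomial.C y) * (Polynomial.X + Polynomial.C z) *
    Polynomial.C (y + z) * Φ with hN
  have hNeq : N = Polynomial.C (y + z) * Polynomial.X ^ 2 ^ k + low := by
    rw [h, hlow, Polynomial.taylor_X_pow, pow_succ (_ + _) (2 ^ k), add_pow_char_pow,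
      Polynomial.C_add (a := _ ^ _), Polynomial.C_pow, Polynomial.C_pow]
    linear_combination Polynomial.X ^ (2 ^ k + 1) * h2
  have hNd : N.natDegree = 2 ^ k := by
    rw [hNeq, Polynomial.natDegree_add_eq_left_of_natDegree_lt] <;>
      rw [Polynomial.natDegree_C_mul_X_pow _ _ hw]
    exact hlowd
  have hNl : N.leadingCoeff = y + z := by
    rw [Polynomial.leadingCoeff, hNd, hNeq, Polynomial.coeff_add, Polynomial.coeff_C_mul,
      Polynomial.coeff_X_pow_self, Polynomial.coeff_eq_zero_of_natDegree_lt hlowd, mul_one,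
      add_zero]
  have hΦ0 : Φ ≠ 0 := by
    rintro rfl
    rw [hN, mul_zero, Polynomial.natDegree_zero] at hNd
    omega
  have hΦm : Φ.Monic := by
    rw [hN, Polynomial.leadingCoeff_mul, Polynomial.leadingCoeff_mul, hm.leadingCoeff, one_mul,
      Polynomial.leadingCoeff_C] at hNl
    exact mul_left_cancel₀ hw (by rw [hNl, mul_one])
  have hΦd : Φ.natDegree = 2 ^ k - 2 := by
    rw [hN, Polynomial.natDegree_mul (mul_ne_zero hm.ne_zero (Polynomial.C_ne_zero.2 hw)) hΦ0,
      Polynomial.natDegree_mul hm.ne_zero (Polynomial.C_ne_zero.2 hw), hmd,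
      Polynomial.natDegree_C] at hNd
    omega
  refine ⟨hΦm, hΦd, fun hder => ?_⟩
  have h3 : Polynomial.C ((y + z) ^ 2) * Φ = Polynomial.C ((y + z) ^ 2 ^ k) +
      (Polynomial.derivative H + Polynomial.taylor (y + z) (Polynomial.derivative H)) := by
    have hl : Polynomial.derivative N = Polynomial.C ((y + z) ^ 2) * Φ := by
      rw [hN, Polynomial.derivative_mul, hder]
      simp only [Polynomial.derivative_mul, Polynomial.derivative_X, Polynomial.derivative_C,
        map_add, map_pow]
      linear_combination Polynomial.X * (Polynomial.C y + Polynomial.C z) * Φ * h2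
    have hq : ((2 ^ k : ℕ) : R) = 0 := by
      rw [Nat.cast_pow, Nat.cast_two, CharTwo.two_eq_zero, zero_pow (by omega)]
    rw [← hl, hNeq, hlow]
    simp only [Polynomial.taylor_apply, Polynomial.derivative_comp, Polynomial.derivative_add,
      Polynomial.derivative_C_mul, Polynomial.derivative_X_pow, Polynomial.derivative_C,
      Polynomial.derivative_X, hq, Polynomial.C_0, zero_mul, mul_zero, zero_add, one_mul, mul_one,
      add_zero]
  have h4 := congrArg (fun p => p.coeff (2 ^ k - 2)) h3
  beta_reduce at h4
  rw [Polynomial.coeff_C_mul, ← hΦd, hΦm.coeff_natDegree, hΦd, Polynomial.coeff_add,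
    Polynomial.coeff_add, add_coeff_taylor_eq_zero, Polynomial.coeff_C_of_ne_zero (by omega),
    mul_one, add_zero] at h4
  · exact pow_ne_zero 2 hw h4
  · exact (Polynomial.natDegree_derivative_le H).trans (by omega)

theorem finSuccEquiv_map {R S : Type*} [CommRing R] [CommRing S] {n : ℕ} (g : R →+* S)
    (p : MvPolynomial (Fin (n + 1)) R) :
    finSuccEquiv S n (map g p) = (finSuccEquiv R n p).map (map g) := by
  ext i m
  rw [finSuccEquiv_coeff_coeff, coeff_map, Polynomial.coeff_map, coeff_map,
    finSuccEquiv_coeff_coeff]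

theorem finSuccEquiv_delta3 (K : Type) [Field K] :
    finSuccEquiv K 2 (delta3 K) = (Polynomial.X + Polynomial.C (X 0)) *
      (Polynomial.X + Polynomial.C (X 1)) * Polynomial.C (X 0 + X 1) := by
  have h1 : finSuccEquiv K 2 (X 1) = Polynomial.C (X 0) := finSuccEquiv_X_succ (j := 0)
  have h2 : finSuccEquiv K 2 (X 2) = Polynomial.C (X 1) := finSuccEquiv_X_succ (j := 1)
  simp only [delta3, map_mul, map_add, finSuccEquiv_X_zero, h1, h2]

theorem finSuccEquiv_phiNum {K : Type} [Field K] (F : Polynomial K) :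
    finSuccEquiv K 2 (phiNum F) = F.map C + Polynomial.taylor (X 0 + X 1) (F.map C) +
      Polynomial.C (Polynomial.aeval (X 0) F + Polynomial.aeval (X 1) F) := by
  have h1 : finSuccEquiv K 2 (X 1) = Polynomial.C (X 0) := finSuccEquiv_X_succ (j := 0)
  have h2 : finSuccEquiv K 2 (X 2) = Polynomial.C (X 1) := finSuccEquiv_X_succ (j := 1)
  have h3 : ∀ u : Polynomial (MvPolynomial (Fin 2) K),
      Polynomial.aeval u F = (F.map C).comp u := fun u => by
    rw [Polynomial.comp, Polynomial.eval₂_map, Polynomial.aeval_def]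
    rfl
  have h4 : ∀ u : MvPolynomial (Fin 2) K, Polynomial.aeval (Polynomial.C u) F =
      Polynomial.C (Polynomial.aeval u F) := fun u =>
    Polynomial.aeval_algHom_apply (IsScalarTower.toAlgHom K (MvPolynomial (Fin 2) K)
      (Polynomial (MvPolynomial (Fin 2) K))) u F
  have h5 : ∀ u, finSuccEquiv K 2 (Polynomial.aeval u F) =
      Polynomial.aeval (finSuccEquiv K 2 u) F := fun u =>
    (Polynomial.aeval_algHom_apply (finSuccEquiv K 2).toAlgHom u F).symm
  simp only [phiNum, map_add, h5, finSuccEquiv_X_zero, h1, h2, h4]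
  rw [h3, h3, Polynomial.comp_X, Polynomial.taylor_apply, ← Polynomial.C_add,
    add_assoc Polynomial.X,
    ← Polynomial.C_add, add_assoc (F.map C), ← Polynomial.C_add, add_right_comm]

theorem eval_ne_zero_of_irreducible {R : Type*} [CommRing R] [IsDomain R] {p : Polynomial R}
    (hp : Irreducible p) (hd : 2 ≤ p.natDegree) (a : R) : p.eval a ≠ 0 := by
  intro h0
  obtain ⟨g, hg⟩ := Polynomial.dvd_iff_isRoot.2 h0
  have := (hp.isUnit_or_isUnit hg).resolve_left (Polynomial.not_isUnit_X_sub_C a)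
  rw [hg, Polynomial.natDegree_mul (Polynomial.X_sub_C_ne_zero a) this.ne_zero,
    Polynomial.natDegree_X_sub_C, Polynomial.natDegree_eq_zero_of_isUnit this] at hd
  omega

theorem exists_rational_zero_phiNum {K : Type} [Field K] [CharP K 2] [IsAlgClosed K] {n k : ℕ}
    (hn : 0 < n) (hk : 2 ≤ k) {H : Polynomial K} (hH : H.natDegree < 2 ^ k)
    {φ : MvPolynomial (Fin 3) K}
    (hφ : delta3 K * φ = phiNum (Polynomial.X ^ (2 ^ k + 1) + H)) (hirr : Irreducible φ)
    (hfr : ∀ t, map (iterateFrobenius K 2 (n * t)) φ = φ) :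
    ∃ m₀, ∀ m ≥ m₀, ∃ x y z : K, x ^ 2 ^ (n * m) = x ∧ y ^ 2 ^ (n * m) = y ∧
      z ^ 2 ^ (n * m) = z ∧ x ≠ y ∧ x ≠ z ∧ y ≠ z ∧
      eval ![x, y, z] (phiNum (Polynomial.X ^ (2 ^ k + 1) + H)) = 0 := by
  have hk4 : 4 ≤ 2 ^ k := Nat.pow_le_pow_right two_pos hk
  have hw : (X 0 + X 1 : MvPolynomial (Fin 2) K) ≠ 0 := fun h0 => by
    have := congrArg (eval ![1, 0]) h0
    simp at this
  have h1 := congrArg (finSuccEquiv K 2) hφ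
  rw [map_mul, finSuccEquiv_delta3, finSuccEquiv_phiNum] at h1
  obtain ⟨hm, hd, hder⟩ := monic_and_derivative_ne_zero_of_mul_eq (H := H.map C)
    (c := Polynomial.aeval (X 0) (Polynomial.X ^ (2 ^ k + 1) + H) +
      Polynomial.aeval (X 1) (Polynomial.X ^ (2 ^ k + 1) + H)) hw hk
    (Polynomial.natDegree_map_le.trans_lt hH) (h1.trans (by
      rw [Polynomial.map_add, Polynomial.map_pow, Polynomial.map_X, map_add (Polynomial.taylor _)]
      abel))
  have hirr' : Irreducible (finSuccEquiv K 2 φ) :=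
    (MulEquiv.irreducible_iff (finSuccEquiv K 2)).2 hirr
  have hne := eval_ne_zero_of_irreducible hirr' (by omega)
  obtain ⟨m₀, hm₀⟩ := exists_rational_point 2 hn hm hirr'
    (fun t => by rw [← finSuccEquiv_map, hfr]) hder
    (mul_ne_zero (mul_ne_zero hw (hne (X 0))) (hne (X 1)))
  refine ⟨m₀, fun m hmm => ?_⟩
  obtain ⟨a, x, ha, hx, h0, hΔ⟩ := hm₀ m hmm
  rw [map_mul, map_mul, map_add, eval_X, eval_X] at hΔ
  have hroot : ∀ i, eval a ((finSuccEquiv K 2 φ).eval (X i)) =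
      ((finSuccEquiv K 2 φ).map (eval a)).eval (a i) := fun i => by
    rw [Polynomial.eval_map, ← eval_X (f := a) i, Polynomial.eval₂_at_apply]
  have hxi : ∀ i, eval a ((finSuccEquiv K 2 φ).eval (X i)) ≠ 0 → x ≠ a i := by
    rintro i hi rfl
    exact hi ((hroot i).trans h0)
  refine ⟨x, a 0, a 1, hx, ha 0, ha 1, hxi 0 (right_ne_zero_of_mul (left_ne_zero_of_mul hΔ)),
    hxi 1 (right_ne_zero_of_mul hΔ), fun h => left_ne_zero_of_mul (left_ne_zero_of_mul hΔ) ?_, ?_⟩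
  · rw [h]
    exact CharTwo.add_self_eq_zero _
  · have hv : (![x, a 0, a 1] : Fin 3 → K) = Fin.cons x a := by
      ext i
      fin_cases i <;> rfl
    rw [← hφ, map_mul, hv, eval_eq_eval_mv_eval' a x φ, h0, mul_zero]

theorem map_delta3 {L M : Type} [CommRing L] [CommRing M] (g : L →+* M) :
    map g (delta3 L) = delta3 M := by
  simp [delta3]

theorem map_phiNum {L M : Type} [CommRing L] [CommRing M] (g : L →+* M) (f : Polynomial L) :
    map g (phiNum f) = phiNum (f.map g) := by
  have h (u : MvPolynomial (Fin 3) L) : map g (Polynomial.aeval u f) =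
      Polynomial.aeval (map g u) (f.map g) := by
    rw [Polynomial.aeval_def, Polynomial.hom_eval₂, Polynomial.aeval_def, Polynomial.eval₂_map]
    congr 1
    ext c
    simp
  simp [phiNum, h]

theorem eval_phiNum {K : Type} [CommRing K] (f : Polynomial K) (x y z : K) :
    eval ![x, y, z] (phiNum f) = f.eval x + f.eval y + f.eval z + f.eval (x + y + z) := by
  have h (u : MvPolynomial (Fin 3) K) : eval ![x, y, z] (Polynomial.aeval u f) =
      f.eval (eval ![x, y, z] u) := by
    rw [Polynomial.aeval_def, Polynomial.hom_eval₂, Polynomial.eval]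
    congr 1
    ext c
    simp
  simp [phiNum, h]

theorem not_isAPN_of_eval_add_eq_zero {M : Type} [Field M] [Fintype M] [CharP M 2] {g : M → M}
    {x y z : M} (hxy : x ≠ y) (hxz : x ≠ z) (hyz : y ≠ z)
    (h : g x + g y + g z + g (x + y + z) = 0) : ¬ IsAPN g := by
  intro hg
  have h2 : (2 : M) = 0 := CharTwo.two_eq_zero
  have h1 := hg (x + y) (g x + g y) fun h0 => hxy (by linear_combination h0 - y * h2)
  have hsub : ({x, y, z} : Set M) ⊆ {u | g (u + (x + y)) + g u = g x + g y} := by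
    rintro u (rfl | rfl | rfl)
    · rw [Set.mem_ofPred_eq, show u + (u + y) = y by linear_combination u * h2, add_comm]
    · rw [Set.mem_ofPred_eq, show u + (x + u) = x by linear_combination u * h2]
    · rw [Set.mem_ofPred_eq, show u + (x + y) = x + y + u by ring]
      linear_combination h - (g x + g y) * h2
  have h3 := Set.ncard_le_ncard hsub (Set.toFinite _)
  rw [Set.ncard_eq_three.2 ⟨x, y, z, hxy, hxz, hyz, rfl⟩] at h3
  omega

theorem exists_finite_subfield {K : Type} [Field K] [IsAlgClosed K] (p : ℕ) [Fact p.Prime]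
    [CharP K p] {e : ℕ} (he : e ≠ 0) :
    ∃ M : Subfield K, Nat.card M = p ^ e ∧ ∀ x, x ∈ M ↔ x ^ p ^ e = x := by
  obtain ⟨S, hS, hmem⟩ := exists_finset_pow_eq_self (K := K) p he
  let M : Subfield K := (iterateFrobenius K p e).eqLocusField (RingHom.id K)
  have hM : ∀ x, x ∈ M ↔ x ^ p ^ e = x := fun x => Iff.rfl
  refine ⟨M, ?_, hM⟩
  rw [← hS, ← Nat.card_eq_finsetCard]
  exact Nat.card_congr (Equiv.subtypeEquivRight fun x => (hM x).trans (hmem x).symm)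

/-- Let `L = F_q`, `q = 2^n`, `k ≥ 2`, and `f(x) = x^{2^k+1} + h(x)`
where `h` has odd degree `d` with `3 ≤ d < 2^k + 1` and `d` is not of the form
`2^l + 1` with `gcd(l, k) > 1`. Then `φ` is absolutely irreducible and `f` is not
exceptional APN. -/
theorem gold_plus_odd_degree_abs_irred_not_exceptional {n : ℕ} (hn : 0 < n) (L : Type)
    [Field L] [Fintype L] (hcard : Fintype.card L = 2 ^ n)
    (k : ℕ) (hk : 2 ≤ k) (h : Polynomial L)
    (hodd : Odd h.natDegree) (hh3 : 3 ≤ h.natDegree) (hhlt : h.natDegree < 2 ^ k + 1)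
    (hexc : ¬ ∃ l : ℕ, h.natDegree = 2 ^ l + 1 ∧ 1 < Nat.gcd l k)
    (f : Polynomial L) (hf : f = Polynomial.X ^ (2 ^ k + 1) + h)
    (φ : MvPolynomial (Fin 3) L) (hφ : delta3 L * φ = phiNum f) :
    AbsolutelyIrreducible φ ∧ ¬ IsExceptionalAPN f := by
  subst hf
  have : CharP L 2 := charP_of_card_eq_prime_pow (f := n) hcard
  set K := AlgebraicClosure L
  set j : L →+* K := algebraMap L K
  have : CharP K 2 := charP_of_injective_ringHom j.injective 2
  have hφK : delta3 K * map j φ = phiNum (Polynomial.X ^ (2 ^ k + 1) + h.map j) := by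
    rw [← map_delta3 j, ← map_mul, hφ, map_phiNum, Polynomial.map_add, Polynomial.map_pow,
      Polynomial.map_X]
  have hlt : h.natDegree < 2 ^ k := by
    refine lt_of_le_of_ne (by omega) fun h0 => ?_
    rw [h0, Nat.odd_pow_iff (by omega)] at hodd
    exact absurd hodd (by decide)
  have hirr : Irreducible (map j φ) := by
    refine irreducible_of_delta3_mul_eq hφK hk hodd hh3 hhlt (fun l hl => ?_) ?_
      (fun r hr hrk => ?_) ?_
    · exact le_antisymm (not_lt.1 fun h1 => hexc ⟨l, hl, h1⟩)
        (Nat.gcd_pos_of_pos_right l (by omega))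
    · rw [Polynomial.coeff_add, Polynomial.coeff_X_pow_self, Polynomial.coeff_map,
        Polynomial.coeff_eq_zero_of_natDegree_lt hhlt, map_zero, add_zero]
    · rw [Polynomial.coeff_add, Polynomial.coeff_X_pow, if_neg hrk, Polynomial.coeff_map,
        Polynomial.coeff_eq_zero_of_natDegree_lt hr, map_zero, add_zero]
    · rw [Polynomial.coeff_add, Polynomial.coeff_X_pow, if_neg hhlt.ne, zero_add,
        Polynomial.coeff_map, Ne, map_eq_zero]
      exact Polynomial.leadingCoeff_ne_zero.2 (Polynomial.ne_zero_of_natDegree_gt hh3)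
  refine ⟨hirr, fun hexcAPN => ?_⟩
  have hpow : ∀ (t : ℕ) (c : L), c ^ 2 ^ (n * t) = c := fun t c => by
    rw [pow_mul, ← hcard, FiniteField.pow_card_pow]
  have hfr : ∀ t, map (iterateFrobenius K 2 (n * t)) (map j φ) = map j φ := fun t => by
    have hj : (iterateFrobenius K 2 (n * t)).comp j = j := RingHom.ext fun c => by
      rw [RingHom.comp_apply, iterateFrobenius_def, ← map_pow, hpow]
    rw [map_map, hj]
  obtain ⟨m₀, hm₀⟩ := exists_rational_zero_phiNum hn hk
    (Polynomial.natDegree_map_le.trans_lt hlt) hφK hirr hfr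
  obtain ⟨m, hm, hmm⟩ := hexcAPN.2.exists_gt m₀
  obtain ⟨x, y, z, hx, hy, hz, hxy, hxz, hyz, h0⟩ := hm₀ m hmm.le
  obtain ⟨M, hMcard, hM⟩ := exists_finite_subfield (K := K) 2 (e := n * m)
    (Nat.mul_ne_zero hn.ne' (by omega))
  have : Finite M := Nat.finite_of_card_ne_zero (by rw [hMcard]; positivity)
  have := Fintype.ofFinite M
  let e : L →+* M := j.codRestrict M fun c => (hM _).2 (by rw [← map_pow, hpow])
  have he : M.subtype.comp e = j := rfl
  have : CharP M 2 := charP_of_injective_ringHom e.injective 2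
  refine not_isAPN_of_eval_add_eq_zero (x := ⟨x, (hM x).2 hx⟩) (y := ⟨y, (hM y).2 hy⟩)
    (z := ⟨z, (hM z).2 hz⟩) (by simpa using hxy) (by simpa using hxz) (by simpa using hyz) ?_
    (hm M e (by rw [← Nat.card_eq_fintype_card, hMcard, hcard, pow_mul]))
  have heval (u : M) : M.subtype (((Polynomial.X ^ (2 ^ k + 1) + h).map e).eval u) =
      (Polynomial.X ^ (2 ^ k + 1) + h.map j).eval (u : K) := by
    have hX : Polynomial.X ^ (2 ^ k + 1) + h.map j =
        ((Polynomial.X ^ (2 ^ k + 1) + h).map e).map M.subtype := by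
      rw [Polynomial.map_map, he, Polynomial.map_add, Polynomial.map_pow, Polynomial.map_X]
    rw [hX, Polynomial.eval_map M.subtype]
    exact (Polynomial.eval₂_at_apply M.subtype u).symm
  refine M.subtype.injective ?_
  rw [eval_phiNum] at h0
  simp only [map_add M.subtype, heval, map_zero]
  exact h0
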